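/- arXiv:0708.1919 — 2 statements merged into one kernel-verified Lean document; each statement's English description precedes it below -/
import Mathlib

section
/- Let p : ℕ → (0,1] satisfy p(n)·n² → ∞, and let ε > 0, C > 0 and k ≥ 1 be given. Then there exist constants n₀, K and η > 0 such that: whenever n ≥ n₀, G is a graph on vertex set {1,…,n} with d_p(A,B) ≤ C for all A,B ⊆ V(G) with |A|,|B| ≥ ηn, and Π is a partition of V(G) into k parts whose sizes differ by at most 1, there is a partition Π' of V(G) into exactly K parts refining Π that is weakly (ε,p)-regular. -/
open MeasureTheory Set Filter
open scoped ENNReal Classical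

noncomputable section

/-- The (0-based) index of the subinterval `((i)/n, (i+1)/n]` of `[0,1]` containing `x`. -/
def idx (n : ℕ) (x : ℝ) : ℕ := ⌈x * n⌉₊ - 1

/-- The subset of `[0,1]` corresponding to a set of vertices of a graph on `Fin n`:
the union of the intervals `(i/n, (i+1)/n]` for `i ∈ X` (vertices `0`-indexed). -/
def vtxSet (n : ℕ) (X : Finset (Fin n)) : Set ℝ :=
  ⋃ i ∈ X, Ioc ((i : ℝ) / n) (((i : ℝ) + 1) / n)

/-- The kernel associated to a graph `G` on `{1,…,n}` and normalizing constant `p`: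
it takes the value `1/p` on `((i−1)/n, i/n] × ((j−1)/n, j/n]` whenever `ij ∈ E(G)`,
and `0` elsewhere. -/
def graphKernel {n : ℕ} (p : ℝ) (G : SimpleGraph (Fin n)) : ℝ → ℝ → ℝ := fun x y =>
  if h : x ∈ Ioc (0:ℝ) 1 ∧ y ∈ Ioc (0:ℝ) 1 ∧ idx n x < n ∧ idx n y < n then
    (if G.Adj ⟨idx n x, h.2.2.1⟩ ⟨idx n y, h.2.2.2⟩ then 1 / p else 0)
  else 0

/-- The cut norm of `W : [0,1]² → ℝ`. -/
def cutNorm (W : ℝ → ℝ → ℝ) : ℝ :=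
  sSup {r | ∃ S T : Set ℝ, MeasurableSet S ∧ MeasurableSet T ∧
    S ⊆ Icc 0 1 ∧ T ⊆ Icc 0 1 ∧ r = |∫ q in S ×ˢ T, W q.1 q.2|}

/-- `τ` is a Lebesgue-measure-preserving bijection of `[0,1]`. -/
def MPBij (τ : ℝ → ℝ) : Prop :=
  MeasurePreserving τ (volume.restrict (Icc 0 1)) (volume.restrict (Icc 0 1)) ∧
    BijOn τ (Icc 0 1) (Icc 0 1)

/-- The cut distance between two kernels. -/
def cutDist (κ₁ κ₂ : ℝ → ℝ → ℝ) : ℝ :=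
  sInf {r | ∃ τ : ℝ → ℝ, MPBij τ ∧ r = cutNorm (fun x y => κ₁ x y - κ₂ (τ x) (τ y))}

/-- The number of homomorphisms from `F` to `G`. -/
def homCount {α β : Type*} (F : SimpleGraph α) (G : SimpleGraph β) : ℕ :=
  Nat.card (F →g G)

/-- The number of injective homomorphisms (embeddings) from `F` to `G`. -/
def embCount {α β : Type*} (F : SimpleGraph α) (G : SimpleGraph β) : ℕ :=
  Nat.card {φ : F →g G // Function.Injective φ}

/-- The number of edges of a graph. -/
def edgeCount {α : Type*} (F : SimpleGraph α) : ℕ := Nat.card F.edgeSet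

/-- The normalized homomorphism count `t_p(F,G)`. -/
def tDen {α β : Type*} [Fintype α] [Fintype β] (p : ℝ) (F : SimpleGraph α)
    (G : SimpleGraph β) : ℝ :=
  homCount F G / (p ^ edgeCount F * (Fintype.card β : ℝ) ^ Fintype.card α)

/-- The normalized embedding count `s_p(F,G)`. -/
def sDen {α β : Type*} [Fintype α] [Fintype β] (p : ℝ) (F : SimpleGraph α)
    (G : SimpleGraph β) : ℝ :=
  embCount F G / (p ^ edgeCount F * ((Fintype.card β).descFactorial (Fintype.card α) : ℝ))

/-- The homomorphism density `s(F,κ)` of a finite graph in a kernel. -/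
def homDensity {α : Type*} [Fintype α] (F : SimpleGraph α) (κ : ℝ → ℝ → ℝ) : ℝ :=
  ∫ x in Set.univ.pi (fun _ : α => Icc (0:ℝ) 1),
    ∏ e ∈ F.edgeFinset,
      Sym2.lift ⟨fun i j => (κ (x i) (x j) + κ (x j) (x i)) / 2,
        fun i j => by dsimp only; rw [add_comm (κ (x i) (x j)) (κ (x j) (x i))]⟩ e

/-- The homomorphism density as a lower integral (for possibly unbounded kernels). -/
def homDensityL {α : Type*} [Fintype α] (F : SimpleGraph α) (κ : ℝ → ℝ → ℝ) : ℝ≥0∞ :=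
  ∫⁻ x in Set.univ.pi (fun _ : α => Icc (0:ℝ) 1),
    ∏ e ∈ F.edgeFinset,
      Sym2.lift ⟨fun i j => ENNReal.ofReal ((κ (x i) (x j) + κ (x j) (x i)) / 2),
        fun i j => by dsimp only; rw [add_comm (κ (x i) (x j)) (κ (x j) (x i))]⟩ e

/-- A kernel: a symmetric measurable function `[0,1]² → [0,∞)`. -/
def IsKernel (κ : ℝ → ℝ → ℝ) : Prop :=
  Measurable (Function.uncurry κ) ∧ (∀ x y, κ x y = κ y x) ∧ ∀ x y, 0 ≤ κ x y

/-- A kernel taking values in `[0,C]`. -/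
def IsKernelBdd (κ : ℝ → ℝ → ℝ) (C : ℝ) : Prop :=
  Measurable (Function.uncurry κ) ∧ (∀ x y, κ x y = κ y x) ∧ ∀ x y, κ x y ∈ Icc 0 C

/-- A standard kernel: a symmetric measurable function `[0,1]² → [0,1]`. -/
def IsStdKernel (κ : ℝ → ℝ → ℝ) : Prop := IsKernelBdd κ 1

/-- A doubly stochastic measure: a Borel measure on `[0,1]²` both of whose marginals
are Lebesgue measure on `[0,1]`. -/
def IsDoublyStochastic (μ : Measure (ℝ × ℝ)) : Prop :=
  μ.map Prod.fst = volume.restrict (Icc 0 1) ∧ μ.map Prod.snd = volume.restrict (Icc 0 1)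

/-- The quantity `d_μ(κ₁,κ₂)`. -/
def dMu (μ : Measure (ℝ × ℝ)) (κ₁ κ₂ : ℝ → ℝ → ℝ) : ℝ :=
  sSup {r | ∃ S T : Set (ℝ × ℝ), MeasurableSet S ∧ MeasurableSet T ∧
    S ⊆ Icc 0 1 ×ˢ Icc 0 1 ∧ T ⊆ Icc 0 1 ×ˢ Icc 0 1 ∧
    r = |∫ w in S ×ˢ T, (κ₁ w.1.1 w.2.1 - κ₂ w.1.2 w.2.2) ∂(μ.prod μ)|}

/-- Equivalence of kernels via a coupling. -/
def KernelEquiv (κ₁ κ₂ : ℝ → ℝ → ℝ) : Prop :=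
  ∃ μ : Measure (ℝ × ℝ), IsDoublyStochastic μ ∧
    ∀ᵐ w ∂(μ.prod μ), κ₁ w.1.1 w.2.1 = κ₂ w.1.2 w.2.2

/-- `e_G(A,B)`: the number of ordered pairs `(i,j) ∈ A × B` with `ij ∈ E(G)`. -/
def ePairs {n : ℕ} (G : SimpleGraph (Fin n)) (A B : Finset (Fin n)) : ℕ :=
  ((A ×ˢ B).filter fun q => G.Adj q.1 q.2).card

/-- The normalized density `d_p(A,B)`. -/
def dDens {n : ℕ} (p : ℝ) (G : SimpleGraph (Fin n)) (A B : Finset (Fin n)) : ℝ :=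
  ePairs G A B / (p * A.card * B.card)

/-- A sequence of graphs has density bounded by `C`. -/
def DensityBoundedBy (p : ℕ → ℝ) (G : ∀ n, SimpleGraph (Fin n)) (C : ℝ) : Prop :=
  ∀ ε > (0:ℝ), ∀ δ > (0:ℝ), ∀ᶠ n in atTop, ∀ A B : Finset (Fin n),
    ε * n ≤ A.card → ε * n ≤ B.card → dDens (p n) (G n) A B ≤ C + δ

/-- The parts of a partition of `Fin n` indexed by `Fin k`, given as a colouring. -/
def fiber {n k : ℕ} (c : Fin n → Fin k) (a : Fin k) : Finset (Fin n) :=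
  Finset.univ.filter fun v => c v = a

/-- The finite-type kernel `G/Π` associated to a partition of the vertex set of `G`. -/
def partKernel {n k : ℕ} (p : ℝ) (G : SimpleGraph (Fin n)) (c : Fin n → Fin k) :
    ℝ → ℝ → ℝ := fun x y =>
  if h : x ∈ Ioc (0:ℝ) 1 ∧ y ∈ Ioc (0:ℝ) 1 ∧ idx n x < n ∧ idx n y < n then
    dDens p G (fiber c (c ⟨idx n x, h.2.2.1⟩)) (fiber c (c ⟨idx n y, h.2.2.2⟩))
  else 0

/-- A partition is weakly `(ε,p)`-regular for `G`. -/
def WeaklyRegular {n k : ℕ} (p ε : ℝ) (G : SimpleGraph (Fin n)) (c : Fin n → Fin k) : Prop :=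
  cutNorm (fun x y => graphKernel p G x y - partKernel p G c x y) ≤ ε

/-- `(A,B)` is an `(ε,p)`-regular pair for `G`. -/
def RegPair {n : ℕ} (p ε : ℝ) (G : SimpleGraph (Fin n)) (A B : Finset (Fin n)) : Prop :=
  ∀ A' ⊆ A, ∀ B' ⊆ B, ε * A.card ≤ A'.card → ε * B.card ≤ B'.card →
    |dDens p G A' B' - dDens p G A B| ≤ ε

/-- An `(ε,p)`-regular partition of `G` into `k` parts. -/
def RegPartition {n k : ℕ} (p ε : ℝ) (G : SimpleGraph (Fin n)) (c : Fin n → Fin k) : Prop :=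
  (∀ a : Fin k, (fiber c a).card = n / k ∨ (fiber c a).card = n / k + 1) ∧
  ((Finset.univ.filter (fun q : Fin k × Fin k =>
      q.1 < q.2 ∧ ¬ RegPair p ε G (fiber c q.1) (fiber c q.2))).card : ℝ)
    ≤ ε * ((k : ℝ) * ((k : ℝ) - 1) / 2)

/-- The number of walks `v₀v₁⋯v_ℓ` in `G` with `v_i ∈ X_i` for each `i`. -/
def walkCount {n ℓ : ℕ} (G : SimpleGraph (Fin n)) (X : Fin (ℓ+1) → Finset (Fin n)) : ℕ :=
  Nat.card {v : Fin (ℓ+1) → Fin n //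
    (∀ i, v i ∈ X i) ∧ ∀ i : Fin ℓ, G.Adj (v i.castSucc) (v i.succ)}

/-- `κ(X₀,X₁,…,X_ℓ)`: the kernel analogue of the walk count. -/
def kernelWalk {ℓ : ℕ} (κ : ℝ → ℝ → ℝ) (X : Fin (ℓ+1) → Set ℝ) : ℝ :=
  ∫ x in Set.univ.pi X, ∏ i : Fin ℓ, κ (x i.castSucc) (x i.succ)

/-- `p_t(u,v)`: the number of paths of length `t` in `G` from `u` to `v`. -/
def pathCount {n : ℕ} (G : SimpleGraph (Fin n)) (t : ℕ) (u v : Fin n) : ℕ :=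
  Nat.card {w : Fin (t+1) → Fin n // w 0 = u ∧ w (Fin.last t) = v ∧
    Function.Injective w ∧ ∀ i : Fin t, G.Adj (w i.castSucc) (w i.succ)}

/-- The `i`-th vertex on the `r`-th subdivided edge (from `u r` to `v r`, `ℓ` steps). -/
def pv (ℓ : ℕ) {k m : ℕ} (u v : Fin m → Fin k) (r : Fin m) (i : ℕ) :
    Fin k ⊕ (Fin m × Fin (ℓ - 1)) :=
  if h0 : i = 0 then Sum.inl (u r)
  else if h : i < ℓ then Sum.inr (r, ⟨i - 1, by omega⟩)
  else Sum.inl (v r)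

/-- The `(ℓ−1)`-fold subdivision of the loopless multigraph with `k` vertices and
edges `u r — v r` for `r < m`. -/
def multiSubdiv (ℓ : ℕ) {k m : ℕ} (u v : Fin m → Fin k) :
    SimpleGraph (Fin k ⊕ (Fin m × Fin (ℓ - 1))) :=
  SimpleGraph.fromRel fun a b =>
    ∃ r : Fin m, ∃ i : ℕ, i < ℓ ∧ a = pv ℓ u v r i ∧ b = pv ℓ u v r (i + 1)

/-- Membership in the family `F_ℓ` of `(ℓ−1)`-fold subdivisions of finite loopless
multigraphs. -/
def InFamilyF (ℓ : ℕ) {N : ℕ} (F : SimpleGraph (Fin N)) : Prop :=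
  ∃ (k m : ℕ) (u v : Fin m → Fin k), 1 ≤ k ∧ (∀ r, u r ≠ v r) ∧
    Nonempty (F ≃g multiSubdiv ℓ u v)

/-- The edges of a simple graph on `Fin k`, as ordered pairs `(i,j)` with `i < j`. -/
abbrev edgeIdx {k : ℕ} (F : SimpleGraph (Fin k)) : Type :=
  {q : Fin k × Fin k // q.1 < q.2 ∧ F.Adj q.1 q.2}

/-- The `i`-th vertex on the subdivision of the edge `e` (`t` steps). -/
def spv (t : ℕ) {k : ℕ} {F : SimpleGraph (Fin k)} (e : edgeIdx F) (i : ℕ) :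
    Fin k ⊕ (edgeIdx F × Fin (t - 1)) :=
  if h0 : i = 0 then Sum.inl e.1.1
  else if h : i < t then Sum.inr (e, ⟨i - 1, by omega⟩)
  else Sum.inl e.1.2

/-- The `t`-subdivision `Sub_t(F)` of a simple graph `F`: each edge is replaced by a
path of length `t` through `t−1` new internal vertices. -/
def subdiv (t : ℕ) {k : ℕ} (F : SimpleGraph (Fin k)) :
    SimpleGraph (Fin k ⊕ (edgeIdx F × Fin (t - 1))) :=
  SimpleGraph.fromRel fun a b =>
    ∃ e : edgeIdx F, ∃ i : ℕ, i < t ∧ a = spv t e i ∧ b = spv t e (i + 1)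

/-- The `t`-th power kernel `κ^t`. -/
def kpow (κ : ℝ → ℝ → ℝ) : ℕ → ℝ → ℝ → ℝ
  | 0 => fun _ _ => 0
  | 1 => κ
  | (n + 2) => fun x y => ∫ z in Icc (0:ℝ) 1, kpow κ (n + 1) x z * κ z y

/-- `φ : Fin ℓ → Fin n` is a homomorphism from `F` to `G`. -/
def IsHom {α β : Type*} (F : SimpleGraph α) (G : SimpleGraph β) (φ : α → β) : Prop :=
  ∀ i j, F.Adj i j → G.Adj (φ i) (φ j)

/-- `F` is flat over its induced subgraph `F'` on the first `ℓ` vertices, for the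
sequence `(G_n)` with normalizing function `p`. -/
def FlatOver (p : ℕ → ℝ) (G : ∀ n, SimpleGraph (Fin n)) {k ℓ : ℕ} (h : ℓ ≤ k)
    (F : SimpleGraph (Fin k)) : Prop :=
  ∀ ε > (0:ℝ), ∀ᶠ n in atTop,
    ((Finset.univ.filter (fun φ : Fin ℓ → Fin n =>
        IsHom (F.comap (Fin.castLE h)) (G n) φ ∧
        ε * ((n:ℝ) ^ (k - ℓ) * p n ^ (edgeCount F - edgeCount (F.comap (Fin.castLE h)))) <
          |((Finset.univ.filter (fun ψ : Fin k → Fin n =>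
              IsHom F (G n) ψ ∧ ψ ∘ Fin.castLE h = φ)).card : ℝ) -
            (n:ℝ) ^ (k - ℓ) * p n ^ (edgeCount F - edgeCount (F.comap (Fin.castLE h)))|)).card
      : ℝ)
      ≤ ε * ((Finset.univ.filter (fun φ : Fin ℓ → Fin n =>
          IsHom (F.comap (Fin.castLE h)) (G n) φ)).card : ℝ)

/-- The set of density matrices of balanced partitions of `V(G)` into `k` nonempty
parts. -/
def MsetG (k : ℕ) {n : ℕ} (p : ℝ) (G : SimpleGraph (Fin n)) : Set (Fin k → Fin k → ℝ) :=
  {M | ∃ c : Fin n → Fin k, Function.Surjective c ∧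
    (∀ a b, (fiber c a).card ≤ (fiber c b).card + 1) ∧
    M = fun a b => dDens p G (fiber c a) (fiber c b)}

/-- The closed set of density matrices of partitions of `[0,1]` into `k` parts of
measure `1/k`, for a kernel `κ`. -/
def MsetK (k : ℕ) (κ : ℝ → ℝ → ℝ) : Set (Fin k → Fin k → ℝ) :=
  closure {M | ∃ Q : Fin k → Set ℝ, (∀ a, MeasurableSet (Q a)) ∧
    (Pairwise fun a b => Disjoint (Q a) (Q b)) ∧ (⋃ a, Q a) = Icc 0 1 ∧
    (∀ a, volume (Q a) = 1 / (k : ℝ≥0∞)) ∧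
    M = fun a b => (k : ℝ)^2 * ∫ q in (Q a) ×ˢ (Q b), κ q.1 q.2}

end



section Averaging

variable {X ι κ : Type*} [Fintype X]

/-- The class of `x` in the partition of `X` into the fibres of `c`. -/
noncomputable def classOf (c : X → ι) (x : X) : Finset X := Finset.univ.filter fun y => c y = c x

/-- The average of `h` over the class of `x` in the partition into the fibres of `c`. -/
noncomputable def classAvg (c : X → ι) (h : X → ℝ) (x : X) : ℝ :=
  (∑ y ∈ classOf c x, h y) / (classOf c x).card

lemma mem_classOf {c : X → ι} {x y : X} : y ∈ classOf c x ↔ c y = c x := by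
  simp [classOf]

lemma classOf_congr {c : X → ι} {x y : X} (h : c x = c y) : classOf c x = classOf c y := by
  simp [classOf, h]

lemma classAvg_congr {c : X → ι} (h : X → ℝ) {x y : X} (hxy : c x = c y) :
    classAvg c h x = classAvg c h y := by
  rw [classAvg, classAvg, classOf_congr hxy]

lemma card_classOf_pos (c : X → ι) (x : X) : 0 < (classOf c x).card :=
  Finset.card_pos.2 ⟨x, mem_classOf.2 rfl⟩

lemma sum_mul_classAvg (c : X → ι) (f h : X → ℝ) :
    ∑ x, f x * classAvg c h x = ∑ x, classAvg c f x * h x := by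
  have e1 : ∀ x, f x * classAvg c h x
      = ∑ y, if c y = c x then f x * h y / (classOf c x).card else 0 := by
    intro x
    rw [← Finset.sum_filter, classAvg, mul_div_assoc', Finset.mul_sum, Finset.sum_div]
    rfl
  have e2 : ∀ y, classAvg c f y * h y
      = ∑ x, if c y = c x then f x * h y / (classOf c x).card else 0 := by
    intro y
    rw [classAvg, div_mul_eq_mul_div, Finset.sum_mul, Finset.sum_div, classOf, Finset.sum_filter]
    refine Finset.sum_congr rfl fun x _ => ?_
    by_cases hxy : c x = c y
    · rw [if_pos hxy, if_pos hxy.symm, classOf, hxy]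
    · rw [if_neg hxy, if_neg (Ne.symm hxy)]
  simp_rw [e1, e2]
  exact Finset.sum_comm

lemma classAvg_of_const {c : X → ι} {f : X → ℝ} (hf : ∀ x y, c x = c y → f x = f y) (x : X) :
    classAvg c f x = f x := by
  have hpos : ((classOf c x).card : ℝ) ≠ 0 := by exact_mod_cast (card_classOf_pos c x).ne'
  rw [classAvg, Finset.sum_congr rfl fun y hy => hf y x (mem_classOf.1 hy), Finset.sum_const,
    nsmul_eq_mul, mul_div_cancel_left₀ _ hpos]

lemma sum_mul_classAvg_of_const {c : X → ι} {f : X → ℝ} (hf : ∀ x y, c x = c y → f x = f y)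
    (h : X → ℝ) : ∑ x, f x * classAvg c h x = ∑ x, f x * h x := by
  rw [sum_mul_classAvg]
  simp_rw [classAvg_of_const hf]

lemma sum_classAvg (c : X → ι) (h : X → ℝ) : ∑ x, classAvg c h x = ∑ x, h x := by
  simpa using sum_mul_classAvg_of_const (c := c) (f := fun _ => 1) (fun _ _ _ => rfl) h

lemma classAvg_sub (c : X → ι) (f g : X → ℝ) (x : X) :
    classAvg c (fun y => f y - g y) x = classAvg c f x - classAvg c g x := by
  simp [classAvg, sub_div]

lemma classAvg_nonneg (c : X → ι) {h : X → ℝ} (hh : ∀ x, 0 ≤ h x) (x : X) :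
    0 ≤ classAvg c h x :=
  div_nonneg (Finset.sum_nonneg fun y _ => hh y) (Nat.cast_nonneg _)

lemma classAvg_le_one (c : X → ι) {h : X → ℝ} (hh : ∀ x, h x ≤ 1) (x : X) :
    classAvg c h x ≤ 1 := by
  have hpos : (0 : ℝ) < (classOf c x).card := by exact_mod_cast card_classOf_pos c x
  rw [classAvg, div_le_one hpos]
  simpa using Finset.sum_le_card_nsmul (classOf c x) h 1 fun y _ => hh y

/-- The convex function equal to `x ^ 2` for `x ≤ B` and continued linearly for `x ≥ B`. -/
noncomputable def truncSq (B x : ℝ) : ℝ := 2 * min x B * x - min x B ^ 2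

lemma truncSq_le {B x : ℝ} (hx : 0 ≤ x) : truncSq B x ≤ 2 * B * x := by
  have := mul_le_mul_of_nonneg_right (min_le_right x B) hx
  unfold truncSq
  nlinarith [sq_nonneg (min x B)]

lemma truncSq_nonneg {B x : ℝ} (hB : 0 ≤ B) (hx : 0 ≤ x) : 0 ≤ truncSq B x := by
  have h0 : 0 ≤ min x B := le_min hx hB
  have := mul_le_mul_of_nonneg_left (min_le_left x B) h0
  unfold truncSq
  nlinarith

lemma truncSq_add_le (B x y : ℝ) :
    truncSq B x + 2 * min x B * (y - x) + (min y B - min x B) ^ 2 ≤ truncSq B y := by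
  unfold truncSq
  rcases le_total x B with hx | hx <;> rcases le_total y B with hy | hy <;>
    simp only [min_eq_left, min_eq_right, hx, hy] <;> nlinarith

/-- Refining a partition increases the truncated energy of the averages at least by the squared
`L²` distance between the truncated averages. -/
lemma sum_truncSq_classAvg_add_le {c : X → ι} {c' : X → κ}
    (hcc : ∀ x y, c' x = c' y → c x = c y) (a : X → ℝ) (B : ℝ) :
    ∑ x, truncSq B (classAvg c a x) + ∑ x, (min (classAvg c' a x) B - min (classAvg c a x) B) ^ 2
      ≤ ∑ x, truncSq B (classAvg c' a x) := by
  have hc : ∀ x y, c x = c y → 2 * min (classAvg c a x) B = 2 * min (classAvg c a y) B :=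
    fun x y hxy => by rw [classAvg_congr a hxy]
  have h0 : ∑ x, 2 * min (classAvg c a x) B * (classAvg c' a x - classAvg c a x) = 0 := by
    simp_rw [mul_sub, Finset.sum_sub_distrib]
    rw [sum_mul_classAvg_of_const hc, sum_mul_classAvg_of_const fun x y h => hc x y (hcc x y h),
      sub_self]
  have := Finset.sum_le_sum fun x (_ : x ∈ Finset.univ) =>
    truncSq_add_le B (classAvg c a x) (classAvg c' a x)
  simp only [Finset.sum_add_distrib, h0] at this
  linarith

/-- Splitting off vertices from a partition to reach a prescribed number of parts. -/
lemma exists_surjective_refinement {N : ℕ} (c : X → Fin N) (hN : N ≤ Fintype.card X) :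
    ∃ c' : X → Fin N, Function.Surjective c' ∧ ∀ x y, c' x = c' y → c x = c y := by
  choose f hf using fun i : Set.range c => i.2
  let rep : X → X := fun x => f ⟨c x, x, rfl⟩
  have hrep : ∀ x, c (rep x) = c x := fun x => hf ⟨c x, x, rfl⟩
  have hcard : (Finset.univ.image rep).card ≤ N := by
    calc (Finset.univ.image rep).card ≤ (Finset.univ.image f).card :=
          Finset.card_le_card fun y hy => by
            obtain ⟨x, -, rfl⟩ := Finset.mem_image.1 hy
            exact Finset.mem_image_of_mem _ (Finset.mem_univ _)
      _ ≤ Fintype.card (Set.range c) := Finset.card_image_le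
      _ ≤ Fintype.card (Fin N) := Fintype.card_subtype_le _
      _ = N := Fintype.card_fin N
  obtain ⟨U, hU, -, hUcard⟩ :=
    Finset.exists_subsuperset_card_eq (Finset.subset_univ (Finset.univ.image rep)) hcard
      (by simpa using hN)
  let e : U ≃ Fin N := U.equivFin.trans (finCongr hUcard)
  let g : X → U := fun x =>
    if h : x ∈ U then ⟨x, h⟩ else ⟨rep x, hU (Finset.mem_image_of_mem _ (Finset.mem_univ x))⟩
  have hg : ∀ x, c (g x) = c x := by
    intro x
    by_cases h : x ∈ U
    · simp [g, h]
    · simp [g, h, hrep]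
  refine ⟨e ∘ g, e.surjective.comp fun u => ⟨u, by simp [g]⟩, fun x y hxy => ?_⟩
  rw [← hg x, ← hg y, e.injective hxy]

end Averaging

section CutNorm

lemma prodMap_refines {V ι κ : Type*} {c : V → ι} {c' : V → κ}
    (h : ∀ u v, c' u = c' v → c u = c v) (x y : V × V) (hxy : Prod.map c' c' x = Prod.map c' c' y) :
    Prod.map c c x = Prod.map c c y := by
  simp only [Prod.map, Prod.mk.injEq] at hxy ⊢
  exact ⟨h _ _ hxy.1, h _ _ hxy.2⟩

variable {V ι κ : Type*} [Fintype V]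

/-- All sums of the matrix `M` over combinatorial rectangles are at most `ε` in absolute value. -/
def CutBounded (M : V × V → ℝ) (ε : ℝ) : Prop :=
  ∀ S T : Finset V, |∑ q ∈ S ×ˢ T, M q| ≤ ε

lemma CutBounded.sum_mul_le {M : V × V → ℝ} {ε : ℝ} (hM : ∀ S T : Finset V, ∑ q ∈ S ×ˢ T, M q ≤ ε)
    {f g : V → ℝ} (hf : ∀ v, f v ∈ Icc (0 : ℝ) 1) (hg : ∀ v, g v ∈ Icc (0 : ℝ) 1) :
    ∑ q : V × V, f q.1 * g q.2 * M q ≤ ε := by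
  have key : ∀ (f h : V → ℝ), (∀ v, f v ∈ Icc (0 : ℝ) 1) →
      ∑ v, f v * h v ≤ ∑ v ∈ Finset.univ.filter (fun v => 0 ≤ h v), h v := by
    intro f h hf
    rw [Finset.sum_filter]
    refine Finset.sum_le_sum fun v _ => ?_
    obtain ⟨h0, h1⟩ := hf v
    split_ifs with hv
    · nlinarith
    · nlinarith
  have e1 : ∑ q : V × V, f q.1 * g q.2 * M q = ∑ u, f u * ∑ v, g v * M (u, v) := by
    rw [Fintype.sum_prod_type]
    simp_rw [Finset.mul_sum, mul_assoc]
  rw [e1]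
  refine (key f _ hf).trans ?_
  rw [Finset.sum_comm]
  simp_rw [← Finset.mul_sum]
  refine (key g _ hg).trans ?_
  rw [← Finset.sum_product_right]
  exact hM _ _

lemma CutBounded.abs_sum_mul_le {M : V × V → ℝ} {ε : ℝ} (hM : CutBounded M ε) {f g : V → ℝ}
    (hf : ∀ v, f v ∈ Icc (0 : ℝ) 1) (hg : ∀ v, g v ∈ Icc (0 : ℝ) 1) :
    |∑ q : V × V, f q.1 * g q.2 * M q| ≤ ε := by
  refine abs_le'.2 ⟨CutBounded.sum_mul_le (fun S T => (le_abs_self _).trans (hM S T)) hf hg, ?_⟩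
  have := CutBounded.sum_mul_le (M := fun q => -M q) (ε := ε)
    (fun S T => by rw [Finset.sum_neg_distrib]; exact (neg_le_abs _).trans (hM S T)) hf hg
  simpa [Finset.sum_neg_distrib] using this

lemma classOf_prodMap (c : V → ι) (q : V × V) :
    classOf (Prod.map c c) q = classOf c q.1 ×ˢ classOf c q.2 := by
  ext x
  simp [mem_classOf, Prod.ext_iff]

lemma classAvg_prodMap_mul (c : V → ι) (f g : V → ℝ) (q : V × V) :
    classAvg (Prod.map c c) (fun x => f x.1 * g x.2) q = classAvg c f q.1 * classAvg c g q.2 := by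
  rw [classAvg, classOf_prodMap, Finset.card_product, classAvg, classAvg, div_mul_div_comm,
    Finset.sum_mul_sum, Finset.sum_product, Nat.cast_mul]

lemma sum_product_eq_sum_indicator (M : V × V → ℝ) (S T : Finset V) :
    ∑ q ∈ S ×ˢ T, M q
      = ∑ q : V × V, (if q.1 ∈ S then 1 else 0) * (if q.2 ∈ T then 1 else 0) * M q := by
  have : S ×ˢ T = Finset.univ.filter fun q : V × V => q.1 ∈ S ∧ q.2 ∈ T := by ext; simp
  rw [this, Finset.sum_filter]
  refine Finset.sum_congr rfl fun q _ => ?_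
  split_ifs <;> simp_all

/-- Passing to a refinement at most doubles the cut norm of the deviation from the averages. -/
lemma CutBounded.refine {a : V × V → ℝ} {ε : ℝ} {c : V → ι} {c' : V → κ}
    (h : ∀ u v, c' u = c' v → c u = c v)
    (hc : CutBounded (fun q => a q - classAvg (Prod.map c c) a q) ε) :
    CutBounded (fun q => a q - classAvg (Prod.map c' c') a q) (2 * ε) := by
  intro S T
  set M : V × V → ℝ := fun q => a q - classAvg (Prod.map c c) a q with hM
  have e1 : ∀ q, a q - classAvg (Prod.map c' c') a q
      = M q - classAvg (Prod.map c' c') M q := by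
    intro q
    rw [hM, classAvg_sub, classAvg_of_const (c := Prod.map c' c') (f := classAvg (Prod.map c c) a)
      fun x y hxy => classAvg_congr a (prodMap_refines h x y hxy)]
    ring
  have e2 : ∑ q ∈ S ×ˢ T, classAvg (Prod.map c' c') M q
      = ∑ q : V × V, classAvg c' (fun v => if v ∈ S then 1 else 0) q.1 *
          classAvg c' (fun v => if v ∈ T then 1 else 0) q.2 * M q := by
    rw [sum_product_eq_sum_indicator, sum_mul_classAvg (Prod.map c' c')
      (fun q => (if q.1 ∈ S then (1 : ℝ) else 0) * (if q.2 ∈ T then 1 else 0))]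
    refine Finset.sum_congr rfl fun q _ => ?_
    rw [classAvg_prodMap_mul c' (fun v => if v ∈ S then 1 else 0)
      (fun v => if v ∈ T then 1 else 0)]
  have hind : ∀ (S : Finset V) (v : V),
      classAvg c' (fun v => if v ∈ S then (1 : ℝ) else 0) v ∈ Icc (0 : ℝ) 1 := fun S v =>
    ⟨classAvg_nonneg c' (fun x => by split_ifs <;> norm_num) v,
      classAvg_le_one c' (fun x => by split_ifs <;> norm_num) v⟩
  simp_rw [e1]
  rw [Finset.sum_sub_distrib, e2, two_mul]
  exact (abs_sub _ _).trans (add_le_add (hc S T) (hc.abs_sum_mul_le (hind S) (hind T)))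

end CutNorm

section EnergyIncrement

variable {V ι κ : Type*} [Fintype V]

/-- If `S × T` witnesses that the averages of `a` over the partition `c` are far from `a` in cut
norm, then any refinement of `c` compatible with `S` and `T` has larger truncated energy, provided
the averages rarely exceed the truncation level. -/
lemma truncSq_energy_increment {c : V → ι} {c' : V → κ} (hcc : ∀ u v, c' u = c' v → c u = c v)
    {S T : Finset V} (hS : ∀ u v, c' u = c' v → (u ∈ S ↔ v ∈ S))
    (hT : ∀ u v, c' u = c' v → (u ∈ T ↔ v ∈ T)) {a : V × V → ℝ} {B τ E : ℝ} (hE : 0 ≤ E)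
    (hc : ∑ q, max (classAvg (Prod.map c c) a q - B) 0 ≤ τ)
    (hc' : ∑ q, max (classAvg (Prod.map c' c') a q - B) 0 ≤ τ)
    (hST : E + 2 * τ ≤ |∑ q ∈ S ×ˢ T, (a q - classAvg (Prod.map c c) a q)|) :
    ∑ q, truncSq B (classAvg (Prod.map c c) a q) + E ^ 2 / (Fintype.card V : ℝ) ^ 2
      ≤ ∑ q, truncSq B (classAvg (Prod.map c' c') a q) := by
  set x := classAvg (Prod.map c c) a with hx
  set y := classAvg (Prod.map c' c') a with hy
  have hsum : ∑ q ∈ S ×ˢ T, a q = ∑ q ∈ S ×ˢ T, y q := by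
    rw [sum_product_eq_sum_indicator, sum_product_eq_sum_indicator, hy]
    refine (sum_mul_classAvg_of_const (c := Prod.map c' c')
      (f := fun q => (if q.1 ∈ S then (1 : ℝ) else 0) * (if q.2 ∈ T then 1 else 0)) ?_ a).symm
    intro q r hqr
    simp only [Prod.map, Prod.mk.injEq] at hqr
    simp only [hS _ _ hqr.1, hT _ _ hqr.2]
  have hpt : ∀ q, |y q - x q| ≤ |min (y q) B - min (x q) B| + max (y q - B) 0
      + max (x q - B) 0 := by
    intro q
    have hmm : ∀ t : ℝ, min t B + max (t - B) 0 = t := fun t => by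
      rcases le_total t B with ht | ht <;> simp [ht]
    have h1 := le_max_right (y q - B) 0
    have h2 := le_max_right (x q - B) 0
    rw [abs_le]
    constructor <;>
      linarith [hmm (x q), hmm (y q), le_abs_self (min (y q) B - min (x q) B),
        neg_abs_le (min (y q) B - min (x q) B)]
  have hEle : E ≤ ∑ q, |min (y q) B - min (x q) B| := by
    have h1 : |∑ q ∈ S ×ˢ T, (a q - x q)| ≤ ∑ q, |y q - x q| := by
      rw [Finset.sum_sub_distrib, hsum, ← Finset.sum_sub_distrib]
      exact (Finset.abs_sum_le_sum_abs _ _).trans (Finset.sum_le_sum_of_subset_of_nonneg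
        (Finset.subset_univ _) fun _ _ _ => abs_nonneg _)
    have h2 := Finset.sum_le_sum fun q (_ : q ∈ Finset.univ) => hpt q
    simp only [Finset.sum_add_distrib] at h2
    linarith
  have hsq : E ^ 2 / (Fintype.card V : ℝ) ^ 2 ≤ ∑ q, (min (y q) B - min (x q) B) ^ 2 := by
    refine div_le_of_le_mul₀ (by positivity) (Finset.sum_nonneg fun _ _ => sq_nonneg _) ?_
    have h1 := sq_sum_le_card_mul_sum_sq (s := Finset.univ)
      (f := fun q => |min (y q) B - min (x q) B|)
    simp only [sq_abs, Finset.card_univ, Fintype.card_prod, Nat.cast_mul] at h1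
    nlinarith [pow_le_pow_left₀ hE hEle 2]
  linarith [sum_truncSq_classAvg_add_le (prodMap_refines hcc) a B]

/-- The sum of a matrix over few rows is small if its density on large rectangles is bounded. -/
lemma sum_rows_le {a : V × V → ℝ} (ha : ∀ q, 0 ≤ a q) {B η δ : ℝ} (hB : 0 ≤ B) (hηδ : η ≤ δ)
    (hδ : δ ≤ 1) (hn : 1 ≤ δ * Fintype.card V)
    (hd : ∀ S T : Finset V, η * Fintype.card V ≤ S.card → η * Fintype.card V ≤ T.card →
      ∑ q ∈ S ×ˢ T, a q ≤ B * S.card * T.card)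
    {R : Finset V} (hR : (R.card : ℝ) ≤ δ * Fintype.card V) :
    ∑ q ∈ R ×ˢ Finset.univ, a q ≤ 2 * B * δ * (Fintype.card V : ℝ) ^ 2 := by
  set n : ℝ := (Fintype.card V : ℝ) with hn_def
  have hn0 : 0 ≤ n := Nat.cast_nonneg _
  have hδn : δ * n ≤ n := by nlinarith
  obtain ⟨U, hRU, -, hU⟩ := Finset.exists_subsuperset_card_eq (Finset.subset_univ R)
    (n := ⌈δ * n⌉₊) (by exact_mod_cast hR.trans (Nat.le_ceil _))
    (by rw [Finset.card_univ]; exact Nat.ceil_le.2 hδn)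
  have hU1 : δ * n ≤ U.card := by rw [hU]; exact Nat.le_ceil _
  have hU2 : (U.card : ℝ) ≤ 2 * (δ * n) := by
    rw [hU]; linarith [Nat.ceil_lt_add_one (show 0 ≤ δ * n by linarith)]
  have h1 := hd U Finset.univ (by nlinarith) (by rw [Finset.card_univ]; nlinarith)
  rw [Finset.card_univ, ← hn_def] at h1
  calc ∑ q ∈ R ×ˢ Finset.univ, a q ≤ ∑ q ∈ U ×ˢ Finset.univ, a q :=
        Finset.sum_le_sum_of_subset_of_nonneg (Finset.product_subset_product_left hRU)
          fun q _ _ => ha q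
    _ ≤ B * U.card * n := h1
    _ ≤ B * (2 * (δ * n)) * n := by gcongr
    _ = _ := by ring

/-- Few vertices lie in small parts of a partition into boundedly many parts. -/
lemma card_small_parts_le {N : ℕ} (c : V → Fin N) {t : ℝ} (ht : 0 ≤ t) :
    ((Finset.univ.filter fun v => ((classOf c v).card : ℝ) < t).card : ℝ) ≤ N * t := by
  set R := Finset.univ.filter fun v => ((classOf c v).card : ℝ) < t with hR
  rw [Finset.card_eq_sum_card_fiberwise (s := R) (t := Finset.univ) (f := c) (by simp)]
  push_cast
  have : ∀ i : Fin N, ((R.filter fun v => c v = i).card : ℝ) ≤ t := by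
    intro i
    rcases (R.filter fun v => c v = i).eq_empty_or_nonempty with h | ⟨v, hv⟩
    · simpa [h] using ht
    · obtain ⟨hvR, rfl⟩ := Finset.mem_filter.1 hv
      refine le_trans (Nat.cast_le.2 (Finset.card_le_card fun u hu => ?_))
        (Finset.mem_filter.1 hvR).2.le
      exact mem_classOf.2 (Finset.mem_filter.1 hu).2
  calc ∑ i : Fin N, ((R.filter fun v => c v = i).card : ℝ) ≤ ∑ _i : Fin N, t :=
        Finset.sum_le_sum fun i _ => this i
    _ = N * t := by simp

lemma sum_product_swap {V : Type*} (a : V × V → ℝ) (S T : Finset V) :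
    ∑ q ∈ S ×ˢ T, a q = ∑ q ∈ T ×ˢ S, a q.swap := by
  rw [Finset.sum_product, Finset.sum_product_right]
  rfl

/-- The averages of a matrix of bounded density over a partition into boundedly many parts exceed
the density bound by little on average. -/
lemma sum_excess_le {a : V × V → ℝ} (ha : ∀ q, 0 ≤ a q) {B η δ : ℝ} (hB : 0 ≤ B) (hη : 0 ≤ η)
    (hηδ : η ≤ δ) (hδ : δ ≤ 1) (hn : 1 ≤ δ * Fintype.card V)
    (hd : ∀ S T : Finset V, η * Fintype.card V ≤ S.card → η * Fintype.card V ≤ T.card →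
      ∑ q ∈ S ×ˢ T, a q ≤ B * S.card * T.card)
    {N : ℕ} (hN : N * η ≤ δ) (c : V → Fin N) :
    ∑ q, max (classAvg (Prod.map c c) a q - B) 0 ≤ 4 * B * δ * (Fintype.card V : ℝ) ^ 2 := by
  set R := Finset.univ.filter fun v => ((classOf c v).card : ℝ) < η * Fintype.card V with hR
  have hRcard : (R.card : ℝ) ≤ δ * Fintype.card V := by
    refine (card_small_parts_le c (by positivity)).trans ?_
    rw [← mul_assoc]
    gcongr
  set f : V → ℝ := fun v => if v ∈ R then 1 else 0 with hf
  have hfc : ∀ u v, c u = c v → f u = f v := fun u v huv => by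
    simp only [hf, hR, Finset.mem_filter, classOf_congr huv, Finset.mem_univ, true_and]
  have hf0 : ∀ v, 0 ≤ f v := fun v => by simp only [hf]; split_ifs <;> norm_num
  have havg := classAvg_nonneg (Prod.map c c) ha
  have hpt : ∀ q, max (classAvg (Prod.map c c) a q - B) 0
      ≤ (f q.1 + f q.2) * classAvg (Prod.map c c) a q := by
    intro q
    have hq := havg q
    have hlarge : ∀ v, v ∉ R → η * Fintype.card V ≤ (classOf c v).card := fun v hv => by
      simpa [hR] using hv
    by_cases h1 : q.1 ∈ R
    · have : f q.1 = 1 := if_pos h1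
      refine max_le ?_ ?_ <;> nlinarith [mul_nonneg (hf0 q.2) hq]
    by_cases h2 : q.2 ∈ R
    · have : f q.2 = 1 := if_pos h2
      refine max_le ?_ ?_ <;> nlinarith [mul_nonneg (hf0 q.1) hq]
    have hle : classAvg (Prod.map c c) a q ≤ B := by
      refine div_le_of_le_mul₀ (Nat.cast_nonneg _) hB ?_
      rw [classOf_prodMap, Finset.card_product, Nat.cast_mul, ← mul_assoc]
      exact hd _ _ (hlarge _ h1) (hlarge _ h2)
    exact max_le (by nlinarith [mul_nonneg (add_nonneg (hf0 q.1) (hf0 q.2)) hq])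
      (mul_nonneg (add_nonneg (hf0 q.1) (hf0 q.2)) hq)
  have hrow := sum_rows_le ha hB hηδ hδ hn hd hRcard
  have hcol := sum_rows_le (a := fun q => a q.swap) (fun q => ha _) hB hηδ hδ hn
    (fun S T hS hT => by
      rw [← sum_product_swap]
      exact (hd T S hT hS).trans_eq (by ring)) hRcard
  rw [← sum_product_swap] at hcol
  have hconst : ∀ x y : V × V, Prod.map c c x = Prod.map c c y →
      f x.1 + f x.2 = f y.1 + f y.2 := by
    intro x y hxy
    simp only [Prod.map, Prod.mk.injEq] at hxy
    rw [hfc _ _ hxy.1, hfc _ _ hxy.2]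
  calc ∑ q, max (classAvg (Prod.map c c) a q - B) 0
      ≤ ∑ q, (f q.1 + f q.2) * classAvg (Prod.map c c) a q := Finset.sum_le_sum fun q _ => hpt q
    _ = ∑ q, (f q.1 + f q.2) * a q := sum_mul_classAvg_of_const hconst a
    _ = ∑ q ∈ R ×ˢ Finset.univ, a q + ∑ q ∈ Finset.univ ×ˢ R, a q := by
      rw [sum_product_eq_sum_indicator, sum_product_eq_sum_indicator, ← Finset.sum_add_distrib]
      refine Finset.sum_congr rfl fun q _ => ?_
      simp [hf, add_mul]
    _ ≤ _ := by linarith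

/-- The common refinement of a partition with two sets. -/
noncomputable def refineBy {V : Type*} {N : ℕ} (c : V → Fin N) (S T : Finset V) (v : V) : Fin (N * 4) :=
  finProdFinEquiv (c v, finProdFinEquiv (if v ∈ S then (1 : Fin 2) else 0,
    if v ∈ T then (1 : Fin 2) else 0))

lemma refineBy_eq_iff {V : Type*} {N : ℕ} {c : V → Fin N} {S T : Finset V} {u v : V} :
    refineBy c S T u = refineBy c S T v ↔ c u = c v ∧ (u ∈ S ↔ v ∈ S) ∧ (u ∈ T ↔ v ∈ T) := by
  unfold refineBy
  rw [finProdFinEquiv.injective.eq_iff, Prod.mk.injEq, finProdFinEquiv.injective.eq_iff,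
    Prod.mk.injEq]
  by_cases h1 : u ∈ S <;> by_cases h2 : v ∈ S <;> by_cases h3 : u ∈ T <;> by_cases h4 : v ∈ T <;>
    simp [h1, h2, h3, h4]

/-- Weak regularity for nonnegative matrices of bounded density on large rectangles. -/
lemma exists_cutBounded_refinement {a : V × V → ℝ} (ha : ∀ q, 0 ≤ a q) {B ε η δ : ℝ} (hB : 0 < B)
    (hε : 0 < ε) (hη : 0 ≤ η) (hηδ : η ≤ δ) (hδ : δ ≤ 1) (hn : 1 ≤ δ * Fintype.card V)
    (hd : ∀ S T : Finset V, η * Fintype.card V ≤ S.card → η * Fintype.card V ≤ T.card →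
      ∑ q ∈ S ×ˢ T, a q ≤ B * S.card * T.card)
    (hBδ : 16 * B * δ ≤ ε) {k m : ℕ} (hm : 8 * B ^ 2 < m * ε ^ 2)
    (hN : ((k * 4 ^ m : ℕ) : ℝ) * η ≤ δ) (c : V → Fin k) :
    ∃ c' : V → Fin (k * 4 ^ m), (∀ u v, c' u = c' v → c u = c v) ∧
      CutBounded (fun q => a q - classAvg (Prod.map c' c') a q)
        (ε * (Fintype.card V : ℝ) ^ 2) := by
  set n : ℝ := (Fintype.card V : ℝ) with hn_def
  have hn0 : 0 < n := by
    by_contra h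
    have : n = 0 := le_antisymm (not_lt.1 h) (Nat.cast_nonneg _)
    rw [this] at hn; norm_num at hn
  have key : ∀ i ≤ m, ∃ c' : V → Fin (k * 4 ^ i), (∀ u v, c' u = c' v → c u = c v) ∧
      (CutBounded (fun q => a q - classAvg (Prod.map c' c') a q) (ε * n ^ 2) ∨
        i * (ε ^ 2 / 4 * n ^ 2) ≤ ∑ q, truncSq B (classAvg (Prod.map c' c') a q)) := by
    intro i
    induction i with
    | zero =>
      intro _
      refine ⟨Fin.cast (by simp) ∘ c, fun u v h => Fin.cast_injective _ h, Or.inr ?_⟩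
      simpa using Finset.sum_nonneg fun q _ => truncSq_nonneg hB.le (classAvg_nonneg _ ha q)
    | succ i ih =>
      intro hi
      obtain ⟨c₁, hc₁, hor⟩ := ih (by omega)
      have hexc : ∀ {j : ℕ} (_ : j ≤ m) (d : V → Fin (k * 4 ^ j)),
          ∑ q, max (classAvg (Prod.map d d) a q - B) 0 ≤ 4 * B * δ * n ^ 2 := by
        intro j hj d
        refine sum_excess_le ha hB.le hη hηδ hδ hn hd (le_trans ?_ hN) d
        gcongr
        norm_num
      have step : ∀ S T : Finset V, ∃ c₂ : V → Fin (k * 4 ^ (i + 1)), ∀ u v, c₂ u = c₂ v ↔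
          c₁ u = c₁ v ∧ (u ∈ S ↔ v ∈ S) ∧ (u ∈ T ↔ v ∈ T) := fun S T =>
        ⟨Fin.cast (by ring) ∘ refineBy c₁ S T, fun u v =>
          (Fin.cast_injective _).eq_iff.trans refineBy_eq_iff⟩
      by_cases hreg : CutBounded (fun q => a q - classAvg (Prod.map c₁ c₁) a q) (ε * n ^ 2)
      · obtain ⟨c₂, hc₂⟩ := step ∅ ∅
        simp only [Finset.notMem_empty, and_true] at hc₂
        refine ⟨c₂, fun u v h => hc₁ u v ((hc₂ u v).1 h), Or.inl ?_⟩
        have : classAvg (Prod.map c₂ c₂) a = classAvg (Prod.map c₁ c₁) a := by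
          funext q
          have hcls : ∀ v, classOf c₂ v = classOf c₁ v := fun v => by
            ext u
            simp only [mem_classOf, hc₂]
          simp only [classAvg, classOf_prodMap, hcls]
        rwa [this]
      · have henergy := hor.resolve_left hreg
        simp only [CutBounded, not_forall, not_le] at hreg
        obtain ⟨S, T, hST⟩ := hreg
        obtain ⟨c₂, hc₂⟩ := step S T
        refine ⟨c₂, fun u v h => hc₁ u v ((hc₂ u v).1 h).1, Or.inr ?_⟩
        have hinc := truncSq_energy_increment (c := c₁) (c' := c₂) (a := a) (B := B)
          (τ := 4 * B * δ * n ^ 2) (E := ε / 2 * n ^ 2)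
          (fun u v h => ((hc₂ u v).1 h).1) (S := S) (T := T)
          (fun u v h => ((hc₂ u v).1 h).2.1) (fun u v h => ((hc₂ u v).1 h).2.2)
          (by positivity) (hexc (by omega) c₁) (hexc hi c₂)
          (le_trans (by nlinarith [sq_nonneg n]) hST.le)
        have e : (ε / 2 * n ^ 2) ^ 2 / n ^ 2 = ε ^ 2 / 4 * n ^ 2 := by field_simp; ring
        rw [← hn_def, e] at hinc
        push_cast
        linarith
  obtain ⟨c', hc', hor⟩ := key m le_rfl
  refine ⟨c', hc', hor.resolve_right fun h => ?_⟩
  have hcard : η * n ≤ (Finset.univ : Finset V).card := by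
    rw [Finset.card_univ]; nlinarith
  have htot := hd Finset.univ Finset.univ hcard hcard
  rw [Finset.univ_product_univ, Finset.card_univ, ← hn_def] at htot
  have hupper : ∑ q, truncSq B (classAvg (Prod.map c' c') a q) ≤ 2 * B * (B * n * n) := by
    calc _ ≤ ∑ q, 2 * B * classAvg (Prod.map c' c') a q :=
          Finset.sum_le_sum fun q _ => truncSq_le (classAvg_nonneg _ ha q)
      _ = 2 * B * ∑ q, a q := by rw [← Finset.mul_sum, sum_classAvg]
      _ ≤ _ := by gcongr
  nlinarith [mul_lt_mul_of_pos_right hm (pow_pos hn0 2)]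

end EnergyIncrement

section Kernels

variable {n : ℕ}

/-- The interval of `[0,1]` corresponding to a vertex. -/
def vtxIoc (i : Fin n) : Set ℝ := Ioc ((i : ℝ) / n) (((i : ℝ) + 1) / n)

lemma mem_vtxIoc_iff (i : Fin n) (x : ℝ) :
    x ∈ vtxIoc i ↔ x ∈ Ioc (0 : ℝ) 1 ∧ idx n x = i := by
  have hn : (0 : ℝ) < n := by exact_mod_cast i.pos
  have hi : (i : ℝ) + 1 ≤ n := by exact_mod_cast i.isLt
  have hi0 : (0 : ℝ) ≤ i := Nat.cast_nonneg _
  rw [vtxIoc, mem_Ioc, div_lt_iff₀ hn, le_div_iff₀ hn]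
  have hceil : 0 < x → (idx n x = i ↔ (i : ℝ) < x * n ∧ x * n ≤ i + 1) := by
    intro hx
    have hpos : 0 < ⌈x * n⌉₊ := Nat.ceil_pos.2 (by positivity)
    have : idx n x = i ↔ ⌈x * n⌉₊ = (i : ℕ) + 1 := by unfold idx; omega
    rw [this, Nat.ceil_eq_iff (by omega)]
    simp
  constructor
  · rintro ⟨h1, h2⟩
    have hx : 0 < x := by
      by_contra h
      nlinarith [not_lt.1 h]
    exact ⟨⟨hx, by by_contra h; nlinarith [not_le.1 h]⟩, (hceil hx).2 ⟨h1, h2⟩⟩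
  · rintro ⟨⟨hx, -⟩, h⟩
    exact (hceil hx).1 h

lemma measurableSet_vtxIoc (i : Fin n) : MeasurableSet (vtxIoc i) := measurableSet_Ioc

lemma volume_real_inter_vtxIoc_le (i : Fin n) (S : Set ℝ) :
    volume.real (vtxIoc i ∩ S) ≤ 1 / n := by
  have hn : (0 : ℝ) < n := by exact_mod_cast i.pos
  calc volume.real (vtxIoc i ∩ S) ≤ volume.real (vtxIoc i) :=
        measureReal_mono inter_subset_left (by simp [vtxIoc])
    _ = 1 / n := by
      rw [vtxIoc, Real.volume_real_Ioc_of_le (by gcongr; linarith)]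
      ring

/-- The kernel on `[0,1]` with the values of a matrix. -/
noncomputable def stepKernel (M : Fin n × Fin n → ℝ) : ℝ → ℝ → ℝ := fun x y =>
  if h : x ∈ Ioc (0:ℝ) 1 ∧ y ∈ Ioc (0:ℝ) 1 ∧ idx n x < n ∧ idx n y < n then
    M (⟨idx n x, h.2.2.1⟩, ⟨idx n y, h.2.2.2⟩)
  else 0

lemma stepKernel_eq_sum (M : Fin n × Fin n → ℝ) (q : ℝ × ℝ) :
    stepKernel M q.1 q.2
      = ∑ r : Fin n × Fin n, (vtxIoc r.1 ×ˢ vtxIoc r.2).indicator (fun _ => M r) q := by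
  unfold stepKernel
  split_ifs with h
  · rw [Finset.sum_eq_single (⟨idx n q.1, h.2.2.1⟩, ⟨idx n q.2, h.2.2.2⟩)]
    · rw [indicator_of_mem]
      exact ⟨(mem_vtxIoc_iff _ _).2 ⟨h.1, rfl⟩, (mem_vtxIoc_iff _ _).2 ⟨h.2.1, rfl⟩⟩
    · intro r _ hr
      refine indicator_of_notMem (fun hq => hr ?_) _
      exact Prod.ext (Fin.ext ((mem_vtxIoc_iff _ _).1 hq.1).2.symm)
        (Fin.ext ((mem_vtxIoc_iff _ _).1 hq.2).2.symm)
    · simp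
  · refine (Finset.sum_eq_zero fun r _ => indicator_of_notMem (fun hq => h ?_) _).symm
    obtain ⟨h1, h2⟩ := (mem_vtxIoc_iff _ _).1 hq.1
    obtain ⟨h3, h4⟩ := (mem_vtxIoc_iff _ _).1 hq.2
    exact ⟨h1, h3, h2 ▸ r.1.isLt, h4 ▸ r.2.isLt⟩

lemma setIntegral_stepKernel (M : Fin n × Fin n → ℝ) (S T : Set ℝ) :
    ∫ q in S ×ˢ T, stepKernel M q.1 q.2
      = ∑ r : Fin n × Fin n, volume.real (vtxIoc r.1 ∩ S) * volume.real (vtxIoc r.2 ∩ T) * M r := by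
  simp_rw [stepKernel_eq_sum]
  have hfin : ∀ (i : Fin n) (S : Set ℝ), volume (vtxIoc i ∩ S) ≠ ⊤ := fun i S =>
    measure_ne_top_of_subset inter_subset_left (by simp [vtxIoc])
  have hmeas : ∀ r : Fin n × Fin n, MeasurableSet (vtxIoc r.1 ×ˢ vtxIoc r.2) := fun r =>
    (measurableSet_vtxIoc r.1).prod (measurableSet_vtxIoc r.2)
  have hvol : ∀ r : Fin n × Fin n, (volume.restrict (S ×ˢ T)) (vtxIoc r.1 ×ˢ vtxIoc r.2)
      = volume (vtxIoc r.1 ∩ S) * volume (vtxIoc r.2 ∩ T) := fun r => by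
    rw [Measure.restrict_apply (hmeas r), prod_inter_prod, Measure.volume_eq_prod,
      Measure.prod_prod]
  rw [integral_finsetSum]
  · refine Finset.sum_congr rfl fun r _ => ?_
    rw [integral_indicator_const _ (hmeas r), Measure.real, hvol, ENNReal.toReal_mul, smul_eq_mul]
    rfl
  · intro r _
    refine (integrable_indicator_iff (hmeas r)).2 (integrableOn_const ?_)
    rw [hvol]
    exact ENNReal.mul_ne_top (hfin _ _) (hfin _ _)

lemma cutNorm_stepKernel_le {M : Fin n × Fin n → ℝ} {ε : ℝ} (hε : 0 ≤ ε) (hn : 0 < n)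
    (hM : CutBounded M (ε * (n : ℝ) ^ 2)) : cutNorm (stepKernel M) ≤ ε := by
  have hn' : (0 : ℝ) < n := by exact_mod_cast hn
  refine Real.sSup_le ?_ hε
  rintro _ ⟨S, T, -, -, -, -, rfl⟩
  rw [setIntegral_stepKernel]
  have hI : ∀ (S : Set ℝ) (i : Fin n), n * volume.real (vtxIoc i ∩ S) ∈ Icc (0 : ℝ) 1 := by
    intro S i
    refine ⟨by positivity, ?_⟩
    calc n * volume.real (vtxIoc i ∩ S) ≤ n * (1 / n) :=
          mul_le_mul_of_nonneg_left (volume_real_inter_vtxIoc_le i S) hn'.le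
      _ = 1 := by field_simp
  have h := hM.abs_sum_mul_le (hI S) (hI T)
  have e : ∑ r : Fin n × Fin n, n * volume.real (vtxIoc r.1 ∩ S)
        * (n * volume.real (vtxIoc r.2 ∩ T)) * M r
      = n ^ 2 * ∑ r : Fin n × Fin n, volume.real (vtxIoc r.1 ∩ S)
        * volume.real (vtxIoc r.2 ∩ T) * M r := by
    rw [Finset.mul_sum]
    exact Finset.sum_congr rfl fun r _ => by ring
  rw [e, abs_mul, abs_of_pos (by positivity), mul_comm] at h
  exact le_of_mul_le_mul_right h (by positivity)

/-- The adjacency matrix of a graph normalized by `p`. -/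
noncomputable def normAdj (p : ℝ) (G : SimpleGraph (Fin n)) (q : Fin n × Fin n) : ℝ :=
  if G.Adj q.1 q.2 then 1 / p else 0

lemma sum_normAdj (p : ℝ) (G : SimpleGraph (Fin n)) (A B : Finset (Fin n)) :
    ∑ q ∈ A ×ˢ B, normAdj p G q = ePairs G A B / p := by
  simp only [normAdj]
  rw [← Finset.sum_filter, Finset.sum_const, nsmul_eq_mul, mul_one_div]
  rfl

lemma dDens_eq (p : ℝ) (G : SimpleGraph (Fin n)) (A B : Finset (Fin n)) :
    dDens p G A B = (∑ q ∈ A ×ˢ B, normAdj p G q) / (A.card * B.card) := by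
  rw [sum_normAdj, dDens, div_div, mul_assoc]

lemma fiber_eq_classOf {k : ℕ} (c : Fin n → Fin k) (v : Fin n) :
    fiber c (c v) = classOf c v := by
  ext u
  simp [fiber, mem_classOf]

lemma graphKernel_sub_partKernel (p : ℝ) (G : SimpleGraph (Fin n)) {k : ℕ} (c : Fin n → Fin k) :
    (fun x y => graphKernel p G x y - partKernel p G c x y)
      = stepKernel fun q => normAdj p G q - classAvg (Prod.map c c) (normAdj p G) q := by
  have hd : ∀ u v, dDens p G (fiber c (c u)) (fiber c (c v))
      = classAvg (Prod.map c c) (normAdj p G) (u, v) := fun u v => by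
    rw [classAvg, classOf_prodMap, Finset.card_product, dDens_eq, Nat.cast_mul,
      fiber_eq_classOf, fiber_eq_classOf]
  funext x y
  unfold graphKernel partKernel stepKernel
  split_ifs with h h'
  · simp only [hd, normAdj, if_pos h']
  · simp only [hd, normAdj, if_neg h']
  · exact sub_zero 0

end Kernels

/-- Sparse weak (Frieze–Kannan) regularity lemma. -/
theorem sparse_weak_regularity (p : ℕ → ℝ) (hp : ∀ n, p n ∈ Ioc (0:ℝ) 1)
    (hpn : Tendsto (fun n => p n * (n:ℝ) ^ 2) atTop atTop)
    (ε C : ℝ) (hε : 0 < ε) (hC : 0 < C) (k : ℕ) (hk : 1 ≤ k) :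
    ∃ (n₀ K : ℕ) (η : ℝ), 0 < η ∧
      ∀ n, n₀ ≤ n → ∀ G : SimpleGraph (Fin n),
        (∀ A B : Finset (Fin n), η * n ≤ A.card → η * n ≤ B.card →
          dDens (p n) G A B ≤ C) →
        ∀ c : Fin n → Fin k, (∀ a b, (fiber c a).card ≤ (fiber c b).card + 1) →
          ∃ c' : Fin n → Fin K, Function.Surjective c' ∧
            (∀ u w : Fin n, c' u = c' w → c u = c w) ∧
            WeaklyRegular (p n) ε G c' := by
  have hε2 : 0 < ε / 2 := half_pos hε
  obtain ⟨m, hm⟩ := exists_nat_gt (8 * C ^ 2 / (ε / 2) ^ 2)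
  rw [div_lt_iff₀ (by positivity)] at hm
  set N := k * 4 ^ m with hN
  have hN1 : 1 ≤ N := Nat.one_le_iff_ne_zero.2 (by positivity)
  have hN1' : (1 : ℝ) ≤ N := by exact_mod_cast hN1
  obtain ⟨δ, hδ0, hδ1, hCδ⟩ : ∃ δ : ℝ, 0 < δ ∧ δ ≤ 1 ∧ 16 * C * δ ≤ ε / 2 := by
    refine ⟨min 1 (ε / 2 / (16 * C)), by positivity, min_le_left _ _, ?_⟩
    rw [mul_comm, ← le_div_iff₀ (by positivity)]
    exact min_le_right _ _
  refine ⟨max N ⌈1 / δ⌉₊, N, δ / N, by positivity, fun n hn G hG c _ => ?_⟩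
  have hnN : N ≤ n := (le_max_left _ _).trans hn
  have hn0 : 0 < n := by omega
  have hδn : 1 ≤ δ * n := by
    rw [mul_comm, ← div_le_iff₀ hδ0]
    exact Nat.ceil_le.1 ((le_max_right _ _).trans hn)
  have hp0 : 0 < p n := (hp n).1
  obtain ⟨c₁, hc₁, hcut⟩ := exists_cutBounded_refinement (a := normAdj (p n) G)
    (fun q => by unfold normAdj; split_ifs <;> positivity) hC hε2
    (η := δ / N) (δ := δ) (by positivity) (div_le_self hδ0.le hN1') hδ1 (by simpa using hδn)
    (fun S T hS hT => by
      rw [Fintype.card_fin] at hS hT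
      have hη : 0 < δ / N * n := by positivity
      have hd := hG S T hS hT
      rw [dDens_eq, div_le_iff₀ (mul_pos (hη.trans_le hS) (hη.trans_le hT))] at hd
      linarith)
    hCδ hm (by rw [← hN]; field_simp; exact le_rfl) c
  obtain ⟨c', hsurj, hc'⟩ := exists_surjective_refinement c₁ (by simpa using hnN)
  refine ⟨c', hsurj, fun u w h => hc₁ u w (hc' u w h), ?_⟩
  rw [WeaklyRegular, graphKernel_sub_partKernel]
  refine cutNorm_stepKernel_le hε.le hn0 ?_
  have := hcut.refine hc'
  rwa [Fintype.card_fin, ← mul_assoc, mul_div_cancel₀ ε two_ne_zero] at this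
end

section
/- Let p : ℕ → (0,1] satisfy p(n)·n² → ∞, and let ε > 0, C > 0 and k ≥ 1 be given. Then there exist constants n₀, K and η > 0 such that: whenever n ≥ n₀, G is a graph on vertex set {1,…,n} with d_p(A,B) ≤ C for all A,B ⊆ V(G) with |A|,|B| ≥ ηn, and Π is a partition of V(G) into k parts whose sizes differ by at most 1, there is an (ε,p)-regular partition Π' of V(G) into at most K parts refining Π. -/
open MeasureTheory Set Filter
open scoped ENNReal Classical

section Averaging

variable {X Y Z : Type*} [Fintype X]

/-- The average of `f` over the fibre of `κ` through a given point. -/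
noncomputable def fibreAverage (κ : X → Y) (f : X → ℝ) (x : X) : ℝ :=
  (∑ y with κ y = κ x, f y) / (Finset.univ.filter fun y => κ y = κ x).card

/-- Averaging over fibres is self-adjoint against functions that are constant on fibres. -/
theorem sum_fibreAverage_mul [Fintype Y] (κ : X → Y) (f h : X → ℝ)
    (hh : ∀ x y, κ x = κ y → h x = h y) :
    ∑ x, fibreAverage κ f x * h x = ∑ x, f x * h x := by
  rw [← Finset.sum_fiberwise Finset.univ κ,
    ← Finset.sum_fiberwise Finset.univ κ (fun x => f x * h x)]
  refine Finset.sum_congr rfl fun b _ => ?_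
  rcases (Finset.univ.filter fun x => κ x = b).eq_empty_or_nonempty with he | ⟨z, hz⟩
  · simp [he]
  have hzb : κ z = b := by simpa using hz
  have hcard : ((Finset.univ.filter fun x => κ x = b).card : ℝ) ≠ 0 := by
    exact_mod_cast (Finset.card_pos.2 ⟨z, hz⟩).ne'
  have hleft : ∀ x ∈ Finset.univ.filter (fun x => κ x = b), fibreAverage κ f x * h x =
      (∑ y with κ y = b, f y) / (Finset.univ.filter fun x => κ x = b).card * h z := by
    intro x hx
    have hxb : κ x = b := by simpa using hx
    rw [fibreAverage, hxb, hh x z (hxb.trans hzb.symm)]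
  have hright : ∀ x ∈ Finset.univ.filter (fun x => κ x = b), f x * h x = f x * h z := by
    intro x hx
    have hxb : κ x = b := by simpa using hx
    rw [hh x z (hxb.trans hzb.symm)]
  rw [Finset.sum_congr rfl hleft, Finset.sum_congr rfl hright, Finset.sum_const, nsmul_eq_mul,
    ← Finset.sum_mul]
  field_simp

theorem fibreAverage_congr (κ : X → Y) (f : X → ℝ) {x y : X} (h : κ x = κ y) :
    fibreAverage κ f x = fibreAverage κ f y := by
  rw [fibreAverage, fibreAverage, h]

/-- Pythagoras' identity for averaging along a refinement. -/
theorem sum_sq_fibreAverage_sub [Fintype Y] [Fintype Z] (κ : X → Y) (κ' : X → Z) (f : X → ℝ)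
    (href : ∀ x y, κ' x = κ' y → κ x = κ y) :
    ∑ x, (fibreAverage κ' f x - fibreAverage κ f x) ^ 2 =
      ∑ x, fibreAverage κ' f x ^ 2 - ∑ x, fibreAverage κ f x ^ 2 := by
  have h₁ := sum_fibreAverage_mul κ' f (fibreAverage κ f)
    fun x y hxy => fibreAverage_congr κ f (href x y hxy)
  have h₂ := sum_fibreAverage_mul κ f (fibreAverage κ f)
    fun x y hxy => fibreAverage_congr κ f hxy
  have h₃ : ∑ x, (fibreAverage κ' f x - fibreAverage κ f x) ^ 2 =
      ∑ x, fibreAverage κ' f x ^ 2 - 2 * ∑ x, fibreAverage κ' f x * fibreAverage κ f x +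
        ∑ x, fibreAverage κ f x * fibreAverage κ f x := by
    rw [Finset.mul_sum, ← Finset.sum_sub_distrib, ← Finset.sum_add_distrib]
    exact Finset.sum_congr rfl fun x _ => by ring
  have h₄ : ∑ x, fibreAverage κ f x ^ 2 = ∑ x, fibreAverage κ f x * fibreAverage κ f x :=
    Finset.sum_congr rfl fun x _ => by ring
  linarith

/-- The sum over a union of fibres is unchanged by averaging. -/
theorem sum_fibreAverage_of_saturated [Fintype Y] (κ : X → Y) (f : X → ℝ) (U : Finset X)
    (hU : ∀ x y, κ x = κ y → x ∈ U → y ∈ U) :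
    ∑ x ∈ U, fibreAverage κ f x = ∑ x ∈ U, f x := by
  have h := sum_fibreAverage_mul κ f (fun x => if x ∈ U then 1 else 0) fun x y hxy => by
    simp only [show x ∈ U ↔ y ∈ U from ⟨hU x y hxy, hU y x hxy.symm⟩]
  simpa using h

end Averaging

section Density

variable {n k : ℕ}

/-- The adjacency indicator of `G`, normalized by `p`. -/
noncomputable def edgeWeight (p : ℝ) (G : SimpleGraph (Fin n)) (q : Fin n × Fin n) : ℝ :=
  if G.Adj q.1 q.2 then 1 / p else 0

theorem sum_edgeWeight (p : ℝ) (G : SimpleGraph (Fin n)) (A B : Finset (Fin n)) :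
    ∑ q ∈ A ×ˢ B, edgeWeight p G q = ePairs G A B / p := by
  simp only [edgeWeight, ← Finset.sum_filter, Finset.sum_const, nsmul_eq_mul, ePairs]
  ring

theorem filter_prodMap_eq (c : Fin n → Fin k) (q : Fin k × Fin k)
    [DecidablePred fun x : Fin n × Fin n => Prod.map c c x = q] :
    (Finset.univ.filter fun x : Fin n × Fin n => Prod.map c c x = q) =
      fiber c q.1 ×ˢ fiber c q.2 := by
  ext x
  simp [fiber, Prod.ext_iff]

theorem fibreAverage_edgeWeight (p : ℝ) (G : SimpleGraph (Fin n)) (c : Fin n → Fin k)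
    (q : Fin n × Fin n) :
    fibreAverage (Prod.map c c) (edgeWeight p G) q =
      dDens p G (fiber c (c q.1)) (fiber c (c q.2)) := by
  rw [fibreAverage, filter_prodMap_eq, sum_edgeWeight, dDens, Finset.card_product]
  simp only [Prod.map_fst, Prod.map_snd]
  push_cast
  rw [div_div, mul_assoc]

/-- The (unnormalized) energy of the partition into the fibres of `c`. -/
noncomputable def energy (p : ℝ) (G : SimpleGraph (Fin n)) (c : Fin n → Fin k) : ℝ :=
  ∑ q, fibreAverage (Prod.map c c) (edgeWeight p G) q ^ 2

theorem energy_nonneg (p : ℝ) (G : SimpleGraph (Fin n)) (c : Fin n → Fin k) :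
    0 ≤ energy p G c :=
  Finset.sum_nonneg fun _ _ => sq_nonneg _

theorem dDens_nonneg {p : ℝ} (hp : 0 < p) (G : SimpleGraph (Fin n)) (A B : Finset (Fin n)) :
    0 ≤ dDens p G A B := by
  unfold dDens; positivity

theorem energy_le {p C : ℝ} (hp : 0 < p) (G : SimpleGraph (Fin n)) (c : Fin n → Fin k)
    (hC : ∀ a b, dDens p G (fiber c a) (fiber c b) ≤ C) :
    energy p G c ≤ C ^ 2 * (n : ℝ) ^ 2 := by
  have h : ∀ q ∈ (Finset.univ : Finset (Fin n × Fin n)),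
      fibreAverage (Prod.map c c) (edgeWeight p G) q ^ 2 ≤ C ^ 2 := fun q _ => by
    rw [fibreAverage_edgeWeight]
    exact pow_le_pow_left₀ (dDens_nonneg hp _ _ _) (hC _ _) 2
  refine (Finset.sum_le_card_nsmul _ _ _ h).trans_eq ?_
  simp [Fintype.card_prod]
  ring

theorem ePairs_mono (G : SimpleGraph (Fin n)) {A A' B B' : Finset (Fin n)} (hA : A' ⊆ A)
    (hB : B' ⊆ B) : ePairs G A' B' ≤ ePairs G A B :=
  Finset.card_le_card (Finset.filter_subset_filter _ (Finset.product_subset_product hA hB))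

theorem ePairs_le_add_sdiff (G : SimpleGraph (Fin n)) {A A' B B' S T : Finset (Fin n)}
    (hA : A' ⊆ A) (hB : B' ⊆ B) :
    ePairs G A' B' ≤ ePairs G S T + (ePairs G (A' \ S) B + ePairs G A (B' \ T)) := by
  unfold ePairs
  refine le_trans (Finset.card_le_card (t := _ ∪ (_ ∪ _)) ?_) ((Finset.card_union_le _ _).trans
    (Nat.add_le_add_left (Finset.card_union_le _ _) _))
  rintro ⟨u, v⟩ h
  simp only [Finset.mem_filter, Finset.mem_product, Finset.mem_union, Finset.mem_sdiff] at h ⊢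
  have := hA h.1.1
  have := hB h.1.2
  tauto

/-- Density bounds on large sets bound the number of edges between arbitrary sets. -/
theorem ePairs_le_of_card_le {p C η : ℝ} (hp : 0 < p) {G : SimpleGraph (Fin n)}
    (hG : ∀ A B : Finset (Fin n), η * n ≤ A.card → η * n ≤ B.card → dDens p G A B ≤ C)
    {A B : Finset (Fin n)} {a b : ℕ} (hA : A.card ≤ a) (hB : B.card ≤ b) (han : a ≤ n)
    (hbn : b ≤ n) (ha : η * n ≤ a) (hb : η * n ≤ b) :
    (ePairs G A B : ℝ) / p ≤ C * a * b := by
  obtain ⟨A₁, hAA, hA₁⟩ := Finset.exists_superset_card_eq hA (by simpa using han)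
  obtain ⟨B₁, hBB, hB₁⟩ := Finset.exists_superset_card_eq hB (by simpa using hbn)
  have h := hG A₁ B₁ (by rwa [hA₁]) (by rwa [hB₁])
  have hle : (ePairs G A B : ℝ) ≤ ePairs G A₁ B₁ := by exact_mod_cast ePairs_mono G hAA hBB
  rw [dDens, hA₁, hB₁] at h
  rw [div_le_iff₀ hp]
  rcases Nat.eq_zero_or_pos a with rfl | ha0
  · obtain rfl : A = ∅ := by simpa using hA
    simp [ePairs]
  rcases Nat.eq_zero_or_pos b with rfl | hb0
  · obtain rfl : B = ∅ := by simpa using hB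
    simp [ePairs]
  rw [div_le_iff₀ (by positivity)] at h
  linarith

end Density

section Equitable

variable {n k : ℕ}

/-- The fibres of `c` all have size `⌊n / k⌋` or `⌊n / k⌋ + 1`. -/
def Equitable (c : Fin n → Fin k) : Prop :=
  ∀ a, (fiber c a).card = n / k ∨ (fiber c a).card = n / k + 1

theorem sum_card_fiber (c : Fin n → Fin k) : ∑ a, (fiber c a).card = n := by
  have h := Finset.card_eq_sum_card_fiberwise (f := c) (s := Finset.univ) (t := Finset.univ)
    (by simp)
  simpa [fiber] using h.symm

theorem equitable_of_card_le_add_one (hk : 1 ≤ k) (c : Fin n → Fin k)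
    (h : ∀ a b, (fiber c a).card ≤ (fiber c b).card + 1) : Equitable c := by
  intro a
  have hsum := sum_card_fiber c
  have hdiv := Nat.div_add_mod n k
  have hmod := Nat.mod_lt n hk
  have hlow : n / k ≤ (fiber c a).card := by
    by_contra! hlt
    have hle : ∑ b, (fiber c b).card < ∑ _b : Fin k, n / k :=
      Finset.sum_lt_sum (fun b _ => by have := h b a; omega) ⟨a, Finset.mem_univ a, hlt⟩
    simp only [Finset.sum_const, Finset.card_univ, Fintype.card_fin, smul_eq_mul] at hle
    omega
  have hup : (fiber c a).card ≤ n / k + 1 := by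
    by_contra! hlt
    have hle : ∑ _b : Fin k, (n / k + 1) ≤ ∑ b, (fiber c b).card :=
      Finset.sum_le_sum (fun b _ => by have := h a b; omega)
    simp only [Finset.sum_const, Finset.card_univ, Fintype.card_fin, smul_eq_mul] at hle
    rw [mul_add] at hle
    omega
  omega

/-- An equitable split of a finset into `t` pieces which almost respects a family of sets. -/
theorem exists_equitable_split {α : Type*} (A : Finset α) (F : Finset (Finset α)) {s t : ℕ}
    (hs : 0 < s) (hlow : t * s ≤ A.card) (hup : A.card ≤ t * (s + 1)) :
    ∃ g : α → ℕ, (∀ v ∈ A, g v < t) ∧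
      (∀ i < t, (A.filter fun v => g v = i).card = s ∨ (A.filter fun v => g v = i).card = s + 1) ∧
      (A.filter fun v => ∃ w ∈ A, g w = g v ∧ ∃ U ∈ F, v ∈ U ∧ w ∉ U).card ≤ 2 ^ F.card * s := by
  have hab : (t - (A.card - t * s)) * s + (A.card - t * s) * (s + 1) = A.card := by
    obtain ⟨b, hb⟩ := Nat.exists_eq_add_of_le hlow
    have hbt : b ≤ t := by rw [hb, mul_add] at hup; omega
    obtain ⟨a, rfl⟩ := Nat.exists_eq_add_of_le hbt
    rw [hb]
    simp only [Nat.add_sub_cancel_left]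
    ring
  set P := Finpartition.atomise A F
  set Q := P.equitabilise hab with hQ
  have hcard : Q.parts.card = t := by
    rw [hQ, P.card_parts_equitabilise hab hs.ne']
    rw [mul_add] at hup
    omega
  let e : Q.parts ≃ Fin t := Q.parts.equivFinOfCardEq hcard
  let g : α → ℕ := fun v => if h : v ∈ A then e ⟨Q.part v, Q.part_mem.2 h⟩ else 0
  have hg : ∀ v (h : v ∈ A), g v = e ⟨Q.part v, Q.part_mem.2 h⟩ := fun v h => dif_pos h
  refine ⟨g, fun v hv => by rw [hg v hv]; exact Fin.is_lt _, fun i hi => ?_, ?_⟩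
  · have hfil : A.filter (fun v => g v = i) = (e.symm ⟨i, hi⟩ : Finset α) := by
      ext v
      rw [Finset.mem_filter, ← Q.part_eq_iff_mem (e.symm ⟨i, hi⟩).2]
      constructor
      · rintro ⟨hv, hvi⟩
        rw [hg v hv] at hvi
        have : e ⟨Q.part v, Q.part_mem.2 hv⟩ = ⟨i, hi⟩ := Fin.ext hvi
        rw [← this, Equiv.symm_apply_apply]
      · intro h
        have hv : v ∈ A := by
          rw [← Q.part_mem, h]
          exact (e.symm ⟨i, hi⟩).2
        refine ⟨hv, ?_⟩
        rw [hg v hv]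
        have : (⟨Q.part v, Q.part_mem.2 hv⟩ : Q.parts) = e.symm ⟨i, hi⟩ := Subtype.ext h
        rw [this, Equiv.apply_symm_apply]
    rw [hfil]
    exact Finpartition.card_eq_of_mem_parts_equitabilise (e.symm ⟨i, hi⟩).2
  · have hsub : (A.filter fun v => ∃ w ∈ A, g w = g v ∧ ∃ U ∈ F, v ∈ U ∧ w ∉ U) ⊆
        P.parts.biUnion fun x => x \ (Q.parts.filter fun y => y ⊆ x).biUnion id := by
      intro v hv
      obtain ⟨hvA, w, hwA, hwv, U, hU, hvU, hwU⟩ := Finset.mem_filter.1 hv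
      have hpart : Q.part w = Q.part v := by
        rw [hg w hwA, hg v hvA] at hwv
        exact congrArg Subtype.val (e.injective (Fin.ext hwv))
      refine Finset.mem_biUnion.2 ⟨P.part v, P.part_mem.2 hvA, Finset.mem_sdiff.2
        ⟨P.mem_part hvA, fun hmem => ?_⟩⟩
      obtain ⟨y, hy, hvy⟩ := Finset.mem_biUnion.1 hmem
      obtain ⟨hyQ, hyP⟩ := Finset.mem_filter.1 hy
      have hwy : w ∈ P.part v := hyP (by
        rw [← Q.part_eq_of_mem hyQ hvy, ← hpart]
        exact Q.mem_part hwA)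
      obtain ⟨-, R, -, hR⟩ := Finpartition.mem_atomise.1 (P.part_mem.2 hvA)
      have hv' : v ∈ P.part v := P.mem_part hvA
      rw [← hR, Finset.mem_filter] at hwy hv'
      exact hwU ((hwy.2 U hU).1 ((hv'.2 U hU).2 hvU))
    refine (Finset.card_le_card hsub).trans ((Finset.card_biUnion_le_card_mul _ _ s fun x hx =>
      P.card_parts_equitabilise_subset_le hab hx).trans ?_)
    exact Nat.mul_le_mul_right _ Finpartition.card_atomise_le

/-- An equitable refinement which almost respects a given family of sets. -/
theorem exists_equitable_refinement {c : Fin n → Fin k} (hc : Equitable c) (t : ℕ)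
    (hpos : 0 < n / (k * t)) (F : Finset (Finset (Fin n))) :
    ∃ c' : Fin n → Fin (k * t), (∀ u w, c' u = c' w → c u = c w) ∧ Equitable c' ∧
      ∀ a, ((fiber c a).filter fun v => ∃ w, c' w = c' v ∧ ∃ U ∈ F, v ∈ U ∧ w ∉ U).card ≤
        2 ^ F.card * (n / (k * t)) := by
  have hdiv : n / (k * t) = n / k / t := (Nat.div_div_eq_div_mul n k t).symm
  have ht : 0 < t := by
    rcases Nat.eq_zero_or_pos t with rfl | h
    · simp at hpos
    · exact h
  have hlow : t * (n / (k * t)) ≤ n / k := by rw [hdiv]; exact Nat.mul_div_le _ _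
  have hup : n / k + 1 ≤ t * (n / (k * t) + 1) := by
    rw [hdiv]; exact Nat.lt_mul_div_succ _ ht
  choose g hlt hsize hbad using fun a => exists_equitable_split (fiber c a) F hpos
    (hlow.trans (by rcases hc a with h | h <;> omega))
    (le_trans (by rcases hc a with h | h <;> omega) hup)
  have hmem : ∀ v, v ∈ fiber c (c v) := fun v => by simp [fiber]
  let c' : Fin n → Fin (k * t) := fun v => finProdFinEquiv (c v, ⟨g (c v) v, hlt _ _ (hmem v)⟩)
  have hc' : ∀ u w, c' u = c' w ↔ c u = c w ∧ g (c u) u = g (c w) w := fun u w => by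
    simp [c', Prod.ext_iff]
  refine ⟨c', fun u w h => ((hc' u w).1 h).1, fun b => ?_, fun a => ?_⟩
  · obtain ⟨⟨a, i⟩, rfl⟩ := finProdFinEquiv.surjective b
    have hfib : fiber c' (finProdFinEquiv (a, i)) = (fiber c a).filter fun v => g a v = i := by
      ext v
      simp only [fiber, Finset.mem_filter, Finset.mem_univ, true_and, c',
        EmbeddingLike.apply_eq_iff_eq, Prod.mk.injEq, Fin.ext_iff (a := (⟨_, _⟩ : Fin t))]
      constructor
      · rintro ⟨rfl, h⟩; exact ⟨rfl, h⟩
      · rintro ⟨rfl, h⟩; exact ⟨rfl, h⟩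
    rw [hfib]
    exact hsize a i i.2
  · refine (Finset.card_le_card fun v hv => ?_).trans (hbad a)
    obtain ⟨hva, w, hw, hU⟩ := Finset.mem_filter.1 hv
    obtain ⟨h₁, h₂⟩ := (hc' w v).1 hw
    have hcv : c v = a := by simpa [fiber] using hva
    simp only [Finset.mem_filter]
    refine ⟨hva, w, by simp [fiber, h₁, hcv], ?_, hU⟩
    rw [h₁, hcv] at h₂
    exact h₂

end Equitable

section EnergyIncrement

variable {n k : ℕ} {p ε C η μ : ℝ} {G : SimpleGraph (Fin n)}

theorem div_two_mul_le_natDiv (h : 0 < n / k) : (n : ℝ) / (2 * k) ≤ (n / k : ℕ) := by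
  have hk : 0 < k := Nat.pos_of_ne_zero fun hk => by simp [hk] at h
  have hkR : (0 : ℝ) < k := by exact_mod_cast hk
  rw [div_le_iff₀ (by positivity)]
  have hlt := Nat.lt_mul_div_succ n hk
  have : n ≤ n / k * (2 * k) := by nlinarith
  exact_mod_cast this

/-- A witness of irregularity keeps a large discrepancy after removing few vertices. -/
theorem le_abs_discrepancy_of_irregular (hp : 0 < p) (hε : 0 < ε) (hμ₀ : 0 < μ) (hμ₁ : μ ≤ 1)
    (hC : 0 < C) (hμ : 12 * μ * C ≤ ε ^ 3)
    (hG : ∀ A B : Finset (Fin n), η * n ≤ A.card → η * n ≤ B.card → dDens p G A B ≤ C)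
    {A B A' B' S T : Finset (Fin n)} (hA1 : 1 ≤ μ * A.card) (hB1 : 1 ≤ μ * B.card)
    (hAη : η * n ≤ μ * A.card) (hBη : η * n ≤ μ * B.card) (hA' : A' ⊆ A) (hB' : B' ⊆ B)
    (hεA : ε * A.card ≤ A'.card) (hεB : ε * B.card ≤ B'.card) (hS : S ⊆ A') (hT : T ⊆ B')
    (hSμ : ((A' \ S).card : ℝ) ≤ μ * A.card) (hTμ : ((B' \ T).card : ℝ) ≤ μ * B.card)
    (hirr : ε < |dDens p G A' B' - dDens p G A B|) :
    ε ^ 3 / 2 * (A.card * B.card) ≤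
      |(ePairs G S T : ℝ) / p - S.card * T.card * dDens p G A B| := by
  have hAn : A.card ≤ n := by simpa using A.card_le_univ
  have hBn : B.card ≤ n := by simpa using B.card_le_univ
  have hApos : (0 : ℝ) < A.card := pos_of_mul_pos_right (by linarith) hμ₀.le
  have hBpos : (0 : ℝ) < B.card := pos_of_mul_pos_right (by linarith) hμ₀.le
  have hA'pos : (0 : ℝ) < A'.card := lt_of_lt_of_le (by positivity) hεA
  have hB'pos : (0 : ℝ) < B'.card := lt_of_lt_of_le (by positivity) hεB
  have hA'le : (A'.card : ℝ) ≤ A.card := by exact_mod_cast Finset.card_le_card hA'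
  have hB'le : (B'.card : ℝ) ≤ B.card := by exact_mod_cast Finset.card_le_card hB'
  have hSle : (S.card : ℝ) ≤ A'.card := by exact_mod_cast Finset.card_le_card hS
  have hTle : (T.card : ℝ) ≤ B'.card := by exact_mod_cast Finset.card_le_card hT
  have hμA : μ * A.card ≤ A.card := mul_le_of_le_one_left hApos.le hμ₁
  have hμB : μ * B.card ≤ B.card := mul_le_of_le_one_left hBpos.le hμ₁
  have hd₀ := dDens_nonneg hp G A B
  have hdC := hG A B (hAη.trans hμA) (hBη.trans hμB)
  set d := dDens p G A B
  have hceilA : (⌈μ * A.card⌉₊ : ℝ) ≤ 2 * μ * A.card := by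
    have := (Nat.ceil_lt_add_one (by positivity : 0 ≤ μ * A.card)).le
    linarith
  have hceilB : (⌈μ * B.card⌉₊ : ℝ) ≤ 2 * μ * B.card := by
    have := (Nat.ceil_lt_add_one (by positivity : 0 ≤ μ * B.card)).le
    linarith
  have hedgeA : (ePairs G (A' \ S) B : ℝ) / p ≤ 2 * μ * C * (A.card * B.card) := by
    refine (ePairs_le_of_card_le hp hG (a := ⌈μ * A.card⌉₊) (b := B.card)
      (by exact_mod_cast hSμ.trans (Nat.le_ceil _)) le_rfl
      ((Nat.ceil_le.2 hμA).trans hAn) hBn (hAη.trans (Nat.le_ceil _)) (hBη.trans hμB)).trans ?_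
    calc C * (⌈μ * A.card⌉₊ : ℝ) * B.card ≤ C * (2 * μ * A.card) * B.card := by gcongr
      _ = _ := by ring
  have hedgeB : (ePairs G A (B' \ T) : ℝ) / p ≤ 2 * μ * C * (A.card * B.card) := by
    refine (ePairs_le_of_card_le hp hG (a := A.card) (b := ⌈μ * B.card⌉₊)
      le_rfl (by exact_mod_cast hTμ.trans (Nat.le_ceil _)) hAn
      ((Nat.ceil_le.2 hμB).trans hBn) (hAη.trans hμA) (hBη.trans (Nat.le_ceil _))).trans ?_
    calc C * A.card * (⌈μ * B.card⌉₊ : ℝ) ≤ C * A.card * (2 * μ * B.card) := by gcongr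
      _ = _ := by ring
  have hup : (ePairs G A' B' : ℝ) / p ≤ ePairs G S T / p + 4 * μ * C * (A.card * B.card) := by
    have h : (ePairs G A' B' : ℝ) ≤
        ePairs G S T + (ePairs G (A' \ S) B + ePairs G A (B' \ T)) := by
      exact_mod_cast ePairs_le_add_sdiff G hA' hB'
    have h' := div_le_div_of_nonneg_right h hp.le
    rw [add_div, add_div] at h'
    linarith
  have hlow : (ePairs G S T : ℝ) / p ≤ ePairs G A' B' / p := by
    have h : (ePairs G S T : ℝ) ≤ ePairs G A' B' := by exact_mod_cast ePairs_mono G hS hT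
    gcongr
  rw [Finset.cast_card_sdiff hS] at hSμ
  rw [Finset.cast_card_sdiff hT] at hTμ
  have hprod : (A'.card : ℝ) * B'.card - S.card * T.card ≤ 2 * μ * (A.card * B.card) := by
    have h₁ : ((A'.card : ℝ) - S.card) * B'.card ≤ μ * A.card * B.card := by gcongr
    have h₂ : (S.card : ℝ) * (B'.card - T.card) ≤ A.card * (μ * B.card) :=
      mul_le_mul (hSle.trans hA'le) hTμ (by linarith) hApos.le
    linarith
  have hprod₀ : (S.card : ℝ) * T.card ≤ A'.card * B'.card := by gcongr
  have hprodd : ((A'.card : ℝ) * B'.card - S.card * T.card) * d ≤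
      2 * μ * C * (A.card * B.card) :=
    calc _ ≤ 2 * μ * (A.card * B.card) * C := mul_le_mul hprod hdC hd₀ (by positivity)
      _ = _ := by ring
  have hprodd₀ : 0 ≤ ((A'.card : ℝ) * B'.card - S.card * T.card) * d :=
    mul_nonneg (by linarith) hd₀
  have hbig : ε ^ 3 * (A.card * B.card) ≤
      |(ePairs G A' B' : ℝ) / p - A'.card * B'.card * d| := by
    have heq : (ePairs G A' B' : ℝ) / p - A'.card * B'.card * d =
        A'.card * B'.card * (dDens p G A' B' - d) := by
      rw [dDens]; field_simp
    rw [heq, abs_mul, abs_of_pos (by positivity)]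
    calc ε ^ 3 * (A.card * B.card) = ε * A.card * (ε * B.card) * ε := by ring
      _ ≤ A'.card * B'.card * |dDens p G A' B' - d| := by gcongr
  have hsmall : |((ePairs G A' B' : ℝ) / p - A'.card * B'.card * d) -
      (ePairs G S T / p - S.card * T.card * d)| ≤ 6 * μ * C * (A.card * B.card) := by
    rw [sub_mul] at hprodd hprodd₀
    rw [abs_le]; constructor <;> linarith
  have hμ' : 6 * μ * C * ((A.card : ℝ) * B.card) ≤ ε ^ 3 / 2 * (A.card * B.card) := by
    gcongr; linarith
  have := abs_sub_abs_le_abs_sub ((ePairs G A' B' : ℝ) / p - A'.card * B'.card * d)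
    (ePairs G S T / p - S.card * T.card * d)
  linarith

/-- A discrepancy on a union of blocks of `c'` inside a block pair of `c` forces a difference in
mean square between the block averages of `c` and `c'`. -/
theorem le_sum_sq_of_discrepancy {l : ℕ} {δ : ℝ} (c : Fin n → Fin k) (c' : Fin n → Fin l)
    {a b : Fin k} {S T : Finset (Fin n)} (hδ : 0 ≤ δ)
    (hS : S ⊆ fiber c a) (hT : T ⊆ fiber c b)
    (hSsat : ∀ u v, c' u = c' v → u ∈ S → v ∈ S) (hTsat : ∀ u v, c' u = c' v → u ∈ T → v ∈ T)
    (hdisc : δ * ((fiber c a).card * (fiber c b).card) ≤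
      |(ePairs G S T : ℝ) / p - S.card * T.card * dDens p G (fiber c a) (fiber c b)|) :
    δ ^ 2 * ((fiber c a).card * (fiber c b).card) ≤
      ∑ q ∈ fiber c a ×ˢ fiber c b, (fibreAverage (Prod.map c' c') (edgeWeight p G) q -
        fibreAverage (Prod.map c c) (edgeWeight p G) q) ^ 2 := by
  set D : Fin n × Fin n → ℝ := fun q => fibreAverage (Prod.map c' c') (edgeWeight p G) q -
        fibreAverage (Prod.map c c) (edgeWeight p G) q with hD
  have hsub : S ×ˢ T ⊆ fiber c a ×ˢ fiber c b := Finset.product_subset_product hS hT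
  have hsum : ∑ q ∈ S ×ˢ T, D q =
      (ePairs G S T : ℝ) / p - S.card * T.card * dDens p G (fiber c a) (fiber c b) := by
    rw [hD, Finset.sum_sub_distrib, sum_fibreAverage_of_saturated, sum_edgeWeight]
    · congr 1
      rw [Finset.sum_congr rfl (g := fun _ => dDens p G (fiber c a) (fiber c b)),
        Finset.sum_const, Finset.card_product, nsmul_eq_mul, Nat.cast_mul]
      intro q hq
      have h := Finset.mem_product.1 (hsub hq)
      simp only [fiber, Finset.mem_filter, Finset.mem_univ, true_and] at h
      rw [fibreAverage_edgeWeight, h.1, h.2]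
    · intro x y hxy hx
      obtain ⟨h₁, h₂⟩ := Prod.ext_iff.1 hxy
      rw [Finset.mem_product] at hx ⊢
      exact ⟨hSsat _ _ h₁ hx.1, hTsat _ _ h₂ hx.2⟩
  rw [← hsum] at hdisc
  have hcs := sq_sum_le_card_mul_sum_sq (s := S ×ˢ T) (f := D)
  have hmono : ∑ q ∈ S ×ˢ T, D q ^ 2 ≤ ∑ q ∈ fiber c a ×ˢ fiber c b, D q ^ 2 :=
    Finset.sum_le_sum_of_subset_of_nonneg hsub fun _ _ _ => sq_nonneg _
  have hcard : ((S ×ˢ T).card : ℝ) ≤ (fiber c a).card * (fiber c b).card := by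
    exact_mod_cast (Finset.card_le_card hsub).trans_eq (Finset.card_product _ _)
  have hsq := pow_le_pow_left₀ (by positivity) hdisc 2
  rw [sq_abs] at hsq
  have hnn : 0 ≤ ∑ q ∈ S ×ˢ T, D q ^ 2 := Finset.sum_nonneg fun _ _ => sq_nonneg _
  have hall : (δ * ((fiber c a).card * (fiber c b).card)) ^ 2 ≤
      ((fiber c a).card * (fiber c b).card) * ∑ q ∈ fiber c a ×ˢ fiber c b, D q ^ 2 :=
    hsq.trans (hcs.trans (mul_le_mul hcard hmono hnn (by positivity)))
  rcases (by positivity : (0 : ℝ) ≤ (fiber c a).card * (fiber c b).card).eq_or_lt with h0 | hpos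
  · rw [← h0, mul_zero]
    exact Finset.sum_nonneg fun _ _ => sq_nonneg _
  · refine le_of_mul_le_mul_left (le_trans (le_of_eq ?_) hall) hpos
    ring

/-- An equitable partition that is not regular has an equitable refinement of larger energy. -/
theorem exists_energy_increment (hp : 0 < p) (hε : 0 < ε) (hμ₀ : 0 < μ)
    (hμ₁ : μ ≤ 1) (hC : 0 < C) (hμ : 12 * μ * C ≤ ε ^ 3)
    (hG : ∀ A B : Finset (Fin n), η * n ≤ A.card → η * n ≤ B.card → dDens p G A B ≤ C)
    {c : Fin n → Fin k} (hc : Equitable c) (hirr : ¬ RegPartition p ε G c) {t : ℕ}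
    (ht : 2 ^ (2 * (k * k)) ≤ μ * t) (hpos : 0 < n / (k * t))
    (h1 : 1 ≤ μ * (n / k : ℕ)) (hη : η * n ≤ μ * (n / k : ℕ)) :
    ∃ c' : Fin n → Fin (k * t), (∀ u w, c' u = c' w → c u = c w) ∧ Equitable c' ∧
      energy p G c + ε ^ 7 / 64 * (n : ℝ) ^ 2 ≤ energy p G c' := by
  set bad := Finset.univ.filter (fun q : Fin k × Fin k =>
      q.1 < q.2 ∧ ¬ RegPair p ε G (fiber c q.1) (fiber c q.2))
  have hcard : ε * ((k : ℝ) * ((k : ℝ) - 1) / 2) < bad.card := by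
    by_contra! h
    exact hirr ⟨hc, h⟩
  have hwit : ∀ q : Fin k × Fin k, ∃ W : Finset (Fin n) × Finset (Fin n), q ∈ bad →
      W.1 ⊆ fiber c q.1 ∧ W.2 ⊆ fiber c q.2 ∧ ε * (fiber c q.1).card ≤ W.1.card ∧
      ε * (fiber c q.2).card ≤ W.2.card ∧
      ε < |dDens p G W.1 W.2 - dDens p G (fiber c q.1) (fiber c q.2)| := by
    intro q
    by_cases hq : q ∈ bad
    · have h := (Finset.mem_filter.1 hq).2.2
      unfold RegPair at h
      push Not at h
      obtain ⟨A', hA', B', hB', h₁, h₂, h₃⟩ := h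
      exact ⟨(A', B'), fun _ => ⟨hA', hB', h₁, h₂, h₃⟩⟩
    · exact ⟨(∅, ∅), fun h => absurd h hq⟩
  choose W hW using hwit
  set F : Finset (Finset (Fin n)) :=
    Finset.univ.image (fun q => (W q).1) ∪ Finset.univ.image (fun q => (W q).2)
  have hF₁ : ∀ q, (W q).1 ∈ F := fun q =>
    Finset.mem_union_left _ (Finset.mem_image_of_mem _ (Finset.mem_univ q))
  have hF₂ : ∀ q, (W q).2 ∈ F := fun q =>
    Finset.mem_union_right _ (Finset.mem_image_of_mem _ (Finset.mem_univ q))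
  have hFcard : F.card ≤ 2 * (k * k) := by
    refine (Finset.card_union_le _ _).trans ?_
    have h₁ := Finset.card_image_le (s := Finset.univ) (f := fun q => (W q).1)
    have h₂ := Finset.card_image_le (s := Finset.univ) (f := fun q => (W q).2)
    simp only [Finset.card_univ, Fintype.card_prod, Fintype.card_fin] at h₁ h₂
    omega
  obtain ⟨c', href, hc', hfew⟩ := exists_equitable_refinement hc t hpos F
  have hsize : ∀ a, n / k ≤ (fiber c a).card := fun a => by
    rcases hc a with h | h <;> omega
  have hfew' : ∀ a, (((fiber c a).filter fun v =>
      ∃ w, c' w = c' v ∧ ∃ U ∈ F, v ∈ U ∧ w ∉ U).card : ℝ) ≤ μ * (fiber c a).card := by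
    intro a
    have htpos : (0 : ℝ) < t := by
      have h : (0 : ℝ) < μ * t := lt_of_lt_of_le (by positivity) ht
      exact pos_of_mul_pos_right h hμ₀.le
    have h₁ : (((fiber c a).filter fun v =>
        ∃ w, c' w = c' v ∧ ∃ U ∈ F, v ∈ U ∧ w ∉ U).card : ℝ) ≤
        2 ^ F.card * (n / (k * t) : ℕ) := by
      exact_mod_cast hfew a
    have h₂ : ((n / (k * t) : ℕ) : ℝ) ≤ (n / k : ℕ) / (t : ℝ) := by
      rw [← Nat.div_div_eq_div_mul]
      exact Nat.cast_div_le
    calc _ ≤ (2 : ℝ) ^ F.card * (n / (k * t) : ℕ) := h₁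
      _ ≤ 2 ^ (2 * (k * k)) * ((n / k : ℕ) / (t : ℝ)) := by
          gcongr
          norm_num
      _ ≤ μ * t * ((n / k : ℕ) / (t : ℝ)) := by gcongr
      _ = μ * (n / k : ℕ) := by field_simp
      _ ≤ _ := by gcongr; exact hsize a
  have hblock : ∀ q ∈ bad, ε ^ 6 / 4 * ((n / k : ℕ) : ℝ) ^ 2 ≤
      ∑ x ∈ fiber c q.1 ×ˢ fiber c q.2, (fibreAverage (Prod.map c' c') (edgeWeight p G) x -
        fibreAverage (Prod.map c c) (edgeWeight p G) x) ^ 2 := by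
    intro q hq
    obtain ⟨hA', hB', hεA, hεB, hd⟩ := hW q hq
    let core : Finset (Fin n) → Finset (Fin n) := fun U =>
      U.filter fun v => ∀ w, c' w = c' v → w ∈ U
    have hcore : ∀ U, core U ⊆ U := fun U => Finset.filter_subset _ _
    have hsat : ∀ U u v, c' u = c' v → u ∈ core U → v ∈ core U := by
      intro U u v huv hu
      simp only [core, Finset.mem_filter] at hu ⊢
      exact ⟨hu.2 v huv.symm, fun w hw => hu.2 w (hw.trans huv.symm)⟩
    have hloss : ∀ U ∈ F, ∀ a, U ⊆ fiber c a →
        ((U \ core U).card : ℝ) ≤ μ * (fiber c a).card := by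
      intro U hU a hUa
      refine le_trans ?_ (hfew' a)
      norm_cast
      refine Finset.card_le_card fun v hv => ?_
      simp only [core, Finset.mem_sdiff, Finset.mem_filter, not_and, not_forall] at hv ⊢
      obtain ⟨hvU, h⟩ := hv
      obtain ⟨w, hw, hwU⟩ := h hvU
      exact ⟨hUa hvU, w, hw, U, hU, hvU, hwU⟩
    have hbound : ∀ a, μ * ((n / k : ℕ) : ℝ) ≤ μ * (fiber c a).card := fun a => by
      gcongr; exact hsize a
    have hdisc := le_abs_discrepancy_of_irregular hp hε hμ₀ hμ₁ hC hμ hG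
      (h1.trans (hbound _)) (h1.trans (hbound _)) (hη.trans (hbound _)) (hη.trans (hbound _))
      hA' hB' hεA hεB (hcore _) (hcore _) (hloss _ (hF₁ q) _ hA') (hloss _ (hF₂ q) _ hB') hd
    refine le_trans ?_ (le_sum_sq_of_discrepancy c c' (by positivity)
      ((hcore _).trans hA') ((hcore _).trans hB') (hsat _) (hsat _) hdisc)
    calc ε ^ 6 / 4 * ((n / k : ℕ) : ℝ) ^ 2
        = (ε ^ 3 / 2) ^ 2 * (((n / k : ℕ) : ℝ) * (n / k : ℕ)) := by ring
      _ ≤ _ := by gcongr <;> exact hsize _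
  refine ⟨c', href, hc', ?_⟩
  have hpyth := sum_sq_fibreAverage_sub (Prod.map c c) (Prod.map c' c') (edgeWeight p G)
    fun x y hxy => Prod.ext (href _ _ (Prod.ext_iff.1 hxy).1) (href _ _ (Prod.ext_iff.1 hxy).2)
  have htotal : bad.card * (ε ^ 6 / 4 * ((n / k : ℕ) : ℝ) ^ 2) ≤
      energy p G c' - energy p G c := by
    rw [energy, energy, ← hpyth, ← nsmul_eq_mul]
    refine (Finset.card_nsmul_le_sum _ _ _ hblock).trans ?_
    rw [← Finset.sum_fiberwise Finset.univ (Prod.map c c)]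
    simp only [filter_prodMap_eq]
    exact Finset.sum_le_sum_of_subset_of_nonneg (Finset.subset_univ _)
      fun _ _ _ => Finset.sum_nonneg fun _ _ => sq_nonneg _
  have hk2 : (2 : ℝ) ≤ k := by
    have hne : bad.Nonempty := by
      rw [← Finset.card_pos]
      have h : (0 : ℝ) ≤ (k : ℝ) * ((k : ℝ) - 1) / 2 := by
        rcases Nat.eq_zero_or_pos k with rfl | h
        · simp
        · have : (1 : ℝ) ≤ k := by exact_mod_cast h
          have := mul_nonneg (Nat.cast_nonneg (α := ℝ) k) (sub_nonneg.2 this)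
          linarith
      exact_mod_cast (mul_nonneg hε.le h).trans_lt hcard
    obtain ⟨q, hq⟩ := hne
    have hlt := (Finset.mem_filter.1 hq).2.1
    have := q.2.is_lt
    have : 2 ≤ k := by have := Fin.lt_def.1 hlt; omega
    exact_mod_cast this
  have hhalf : (n : ℝ) / (2 * k) ≤ (n / k : ℕ) := by
    refine div_two_mul_le_natDiv (Nat.pos_of_ne_zero fun h => ?_)
    rw [h] at h1
    norm_num at h1
  have hfinal : ε ^ 7 / 64 * (n : ℝ) ^ 2 ≤ bad.card * (ε ^ 6 / 4 * ((n / k : ℕ) : ℝ) ^ 2) :=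
    calc ε ^ 7 / 64 * (n : ℝ) ^ 2
        = ε * ((k : ℝ) * (k / 2) / 2) * (ε ^ 6 / 4 * ((n : ℝ) / (2 * k)) ^ 2) := by
          field_simp; ring
      _ ≤ ε * ((k : ℝ) * (k - 1) / 2) * (ε ^ 6 / 4 * ((n / k : ℕ) : ℝ) ^ 2) := by
          have hhalfk : (k : ℝ) / 2 ≤ k - 1 := by linarith
          have hk1 : (0 : ℝ) ≤ k - 1 := by linarith
          gcongr
      _ ≤ _ := by gcongr
  linarith

end EnergyIncrement

theorem RegPair.mono {n : ℕ} {p ε ε' : ℝ} {G : SimpleGraph (Fin n)} {A B : Finset (Fin n)}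
    (hε : ε' ≤ ε) (h : RegPair p ε' G A B) : RegPair p ε G A B :=
  fun A' hA B' hB hA' hB' => (h A' hA B' hB (le_trans (by gcongr) hA')
    (le_trans (by gcongr) hB')).trans hε

theorem RegPartition.mono {n k : ℕ} {p ε ε' : ℝ} {G : SimpleGraph (Fin n)} {c : Fin n → Fin k}
    (hk : 1 ≤ k) (hε : ε' ≤ ε) (h : RegPartition p ε' G c) : RegPartition p ε G c := by
  refine ⟨h.1, le_trans ?_ (h.2.trans ?_)⟩
  · norm_cast
    refine Finset.card_le_card fun q hq => ?_
    simp only [Finset.mem_filter, Finset.mem_univ, true_and] at hq ⊢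
    exact ⟨hq.1, fun hreg => hq.2 (hreg.mono hε)⟩
  · have h1 : (1 : ℝ) ≤ k := by exact_mod_cast hk
    have := mul_nonneg (Nat.cast_nonneg (α := ℝ) k) (sub_nonneg.2 h1)
    gcongr

/-- The number of parts after one refinement step applied to `k` parts. -/
noncomputable def refinedCard (μ : ℝ) (k : ℕ) : ℕ := k * ⌈(2 : ℝ) ^ (2 * (k * k)) / μ⌉₊

theorem le_refinedCard {μ : ℝ} (hμ : 0 < μ) (k : ℕ) : k ≤ refinedCard μ k :=
  Nat.le_mul_of_pos_right _ (Nat.ceil_pos.2 (by positivity))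

/-- Iterating the energy increment finds a regular partition, or else makes the energy large. -/
theorem exists_regular_or_energy_le {n k M K : ℕ} {p ε C η μ : ℝ} {G : SimpleGraph (Fin n)}
    (hp : 0 < p) (hε : 0 < ε) (hμ₀ : 0 < μ) (hμ₁ : μ ≤ 1) (hC : 0 < C) (hμ : 12 * μ * C ≤ ε ^ 3)
    (hG : ∀ A B : Finset (Fin n), η * n ≤ A.card → η * n ≤ B.card → dDens p G A B ≤ C)
    (hk : 1 ≤ k) (hK : ∀ i ≤ M, (refinedCard μ)^[i] k ≤ K) (hKn : K ≤ n)
    (h1 : 1 ≤ μ * (n / (2 * K))) (hη : η * n ≤ μ * (n / (2 * K)))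
    {c : Fin n → Fin k} (hc : Equitable c) :
    ∀ j ≤ M, ∃ k', 1 ≤ k' ∧ k' ≤ K ∧ ∃ c' : Fin n → Fin k', (∀ u w, c' u = c' w → c u = c w) ∧
      (RegPartition p ε G c' ∨ k' = (refinedCard μ)^[j] k ∧ Equitable c' ∧
        j * (ε ^ 7 / 64 * (n : ℝ) ^ 2) ≤ energy p G c') := by
  intro j
  induction j with
  | zero =>
    intro _
    refine ⟨k, hk, hK 0 (Nat.zero_le _), c, fun _ _ h => h, Or.inr ⟨rfl, hc, ?_⟩⟩
    simpa using energy_nonneg p G c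
  | succ j ih =>
    intro hj
    obtain ⟨k', hk', hk'K, c', href, hreg | ⟨hk'j, hc', hen⟩⟩ := ih (by omega)
    · exact ⟨k', hk', hk'K, c', href, Or.inl hreg⟩
    by_cases hreg : RegPartition p ε G c'
    · exact ⟨k', hk', hk'K, c', href, Or.inl hreg⟩
    have hnext : refinedCard μ k' ≤ K := by
      rw [hk'j, ← Function.iterate_succ_apply' (refinedCard μ)]
      exact hK _ hj
    have hpos' : 1 ≤ refinedCard μ k' := hk'.trans (le_refinedCard hμ₀ k')
    have hlow : μ * (n / (2 * K)) ≤ μ * (n / k' : ℕ) := by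
      refine mul_le_mul_of_nonneg_left (le_trans ?_ (div_two_mul_le_natDiv
        (Nat.div_pos (hk'K.trans hKn) hk'))) hμ₀.le
      gcongr
    obtain ⟨c'', href', hc'', hen'⟩ := exists_energy_increment hp hε hμ₀ hμ₁ hC hμ hG hc' hreg
      (t := ⌈(2 : ℝ) ^ (2 * (k' * k')) / μ⌉₊) (by
        have := Nat.le_ceil ((2 : ℝ) ^ (2 * (k' * k')) / μ)
        rwa [div_le_iff₀' hμ₀] at this)
      (Nat.div_pos (hnext.trans hKn) hpos') (h1.trans hlow) (hη.trans hlow)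
    refine ⟨refinedCard μ k', hpos', hnext, c'', fun u w h => href u w (href' u w h),
      Or.inr ⟨?_, hc'', ?_⟩⟩
    · rw [Function.iterate_succ_apply', hk'j]
    · refine le_trans ?_ hen'
      push_cast
      linarith

/-- Sparse Szemerédi regularity lemma. -/
theorem sparse_strong_regularity (p : ℕ → ℝ) (hp : ∀ n, p n ∈ Ioc (0:ℝ) 1)
    (hpn : Tendsto (fun n => p n * (n:ℝ) ^ 2) atTop atTop)
    (ε C : ℝ) (hε : 0 < ε) (hC : 0 < C) (k : ℕ) (hk : 1 ≤ k) :
    ∃ (n₀ K : ℕ) (η : ℝ), 0 < η ∧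
      ∀ n, n₀ ≤ n → ∀ G : SimpleGraph (Fin n),
        (∀ A B : Finset (Fin n), η * n ≤ A.card → η * n ≤ B.card →
          dDens (p n) G A B ≤ C) →
        ∀ c : Fin n → Fin k, (∀ a b, (fiber c a).card ≤ (fiber c b).card + 1) →
          ∃ k' : ℕ, 1 ≤ k' ∧ k' ≤ K ∧ ∃ c' : Fin n → Fin k',
            (∀ u w : Fin n, c' u = c' w → c u = c w) ∧
            RegPartition (p n) ε G c' := by
  set ε' := min ε 1
  have hε₀ : 0 < ε' := lt_min hε one_pos
  set μ := min 1 (ε' ^ 3 / (12 * C))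
  have hμ₀ : 0 < μ := lt_min one_pos (by positivity)
  have hμ₁ : μ ≤ 1 := min_le_left _ _
  have hμ : 12 * μ * C ≤ ε' ^ 3 := by
    have h : μ ≤ ε' ^ 3 / (12 * C) := min_le_right _ _
    rw [le_div_iff₀ (by positivity)] at h
    linarith
  obtain ⟨M, hM⟩ := exists_nat_gt (C ^ 2 / (ε' ^ 7 / 64))
  rw [div_lt_iff₀ (by positivity)] at hM
  set K := (refinedCard μ)^[M] k
  have hmono : Monotone fun i => (refinedCard μ)^[i] k := monotone_nat_of_le_succ fun i => by
    rw [Function.iterate_succ_apply']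
    exact le_refinedCard hμ₀ _
  have hK : ∀ i ≤ M, (refinedCard μ)^[i] k ≤ K := fun i hi => hmono hi
  have hK₁ : 1 ≤ K := hk.trans (hK 0 (Nat.zero_le _))
  have hKR : (0 : ℝ) < K := by exact_mod_cast hK₁
  refine ⟨⌈2 * K / μ⌉₊, K, μ / (2 * K), by positivity, fun n hn G hG c hbal => ?_⟩
  have hnR : 2 * K / μ ≤ (n : ℝ) := Nat.ceil_le.1 hn
  rw [div_le_iff₀ hμ₀] at hnR
  have hKn : K ≤ n := by
    have h : (n : ℝ) * μ ≤ n := mul_le_of_le_one_right (Nat.cast_nonneg n) hμ₁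
    have : (K : ℝ) ≤ n := by linarith
    exact_mod_cast this
  have hnpos : (0 : ℝ) < n := hKR.trans_le (by exact_mod_cast hKn)
  have h1 : 1 ≤ μ * (n / (2 * K)) := by
    rw [← mul_div_assoc, le_div_iff₀ (by positivity)]
    linarith
  have hη : μ / (2 * K) * n ≤ μ * (n / (2 * K)) := le_of_eq (by ring)
  obtain ⟨k', hk', hk'K, c', href, hreg | ⟨-, hc', hen⟩⟩ := exists_regular_or_energy_le
    (hp n).1 hε₀ hμ₀ hμ₁ hC hμ hG hk hK hKn h1 hη
    (equitable_of_card_le_add_one hk c hbal) M le_rfl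
  · exact ⟨k', hk', hk'K, c', href, hreg.mono hk' (min_le_left _ _)⟩
  · have hlarge : ∀ a, μ / (2 * K) * n ≤ (fiber c' a).card := fun a => by
      have hcard : n / k' ≤ (fiber c' a).card := by rcases hc' a with h | h <;> omega
      calc μ / (2 * K) * n ≤ 1 / (2 * k') * n := by gcongr
        _ = n / (2 * k') := by ring
        _ ≤ (n / k' : ℕ) := div_two_mul_le_natDiv (Nat.div_pos (hk'K.trans hKn) hk')
        _ ≤ (fiber c' a).card := by exact_mod_cast hcard
    have hle := energy_le (hp n).1 G c' fun a b => hG _ _ (hlarge a) (hlarge b)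
    have hlt : C ^ 2 * (n : ℝ) ^ 2 < M * (ε' ^ 7 / 64) * (n : ℝ) ^ 2 := by gcongr
    linarith
end
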